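/- arXiv:1606.09618 — 6 statements merged into one kernel-verified Lean document; each statement's English description precedes it below -/
import Mathlib

section
/- The set of rational points (x, y) ∈ ℚ × ℚ satisfying y² = x·(x−1)·(x−2)·(x−5)·(x−6) is exactly the nine-element set {(0,0), (1,0), (2,0), (5,0), (6,0), (3,6), (3,−6), (10,120), (10,−120)}. -/
namespace GG

/-- Every nonzero factor of a square is a squarefree number times a square,
and the squarefree part divides the cofactor. -/
lemma exists_sf (N M Y : ℤ) (hN : N ≠ 0) (h : N * M = Y ^ 2) :
    ∃ d u : ℤ, N = d * u ^ 2 ∧ d ∣ M ∧ Squarefree d := by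
  obtain ⟨a, b, hab, ha⟩ := Nat.sq_mul_squarefree N.natAbs
  have key : ∃ d : ℤ, N = d * (b : ℤ) ^ 2 ∧ Squarefree d := by
    have h1 : ((b : ℤ) ^ 2 * a) = |N| := by
      rw [Int.abs_eq_natAbs, ← hab]; push_cast; ring
    have h2 : Squarefree (a : ℤ) := Int.squarefree_natCast.mpr ha
    rcases abs_choice N with h3 | h3
    · exact ⟨a, by rw [← h3, ← h1]; ring, h2⟩
    · refine ⟨-a, by linear_combination h1 + h3, ?_⟩
      rwa [← Int.squarefree_natAbs, Int.natAbs_neg, Int.squarefree_natAbs]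
  obtain ⟨d, hd, hsq⟩ := key
  refine ⟨d, b, hd, ?_, hsq⟩
  have hb : (b : ℤ) ≠ 0 := by
    rintro h0; rw [h0] at hd; simp at hd; exact hN hd
  have hd0 : d ≠ 0 := hsq.ne_zero
  have h4 : (b : ℤ) ∣ Y := by
    have : (b : ℤ) ^ 2 ∣ Y ^ 2 := ⟨d * M, by rw [← h, hd]; ring⟩
    exact (Int.pow_dvd_pow_iff (by norm_num)).mp this
  obtain ⟨Z, rfl⟩ := h4
  have h5 : d * M = Z ^ 2 := by
    have : (b : ℤ) ^ 2 * (d * M) = (b : ℤ) ^ 2 * Z ^ 2 := by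
      rw [hd] at h; linear_combination h
    exact mul_left_cancel₀ (pow_ne_zero 2 hb) this
  have h6 : d ∣ Z := (hsq.dvd_pow_iff_dvd (by norm_num : (2 : ℕ) ≠ 0)).mp ⟨M, h5.symm⟩
  obtain ⟨W, rfl⟩ := h6
  exact ⟨W ^ 2, mul_left_cancel₀ hd0 (by linear_combination h5)⟩

lemma den_sq (P D : ℤ) (z : ℚ) (hD : 0 < D) (hc : IsCoprime P D)
    (h : ((P * D : ℤ) : ℚ) = z ^ 2) : (∃ e : ℤ, 0 < e ∧ D = e ^ 2) ∧ ∃ Y : ℤ, P = Y ^ 2 := by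
  have h1 : IsSquare ((P * D : ℤ) : ℚ) := ⟨z, by rw [h]; ring⟩
  rw [Rat.isSquare_intCast_iff] at h1
  obtain ⟨Y, hY⟩ := h1
  have hY' : D * P = Y ^ 2 := by linear_combination hY
  obtain ⟨e, he⟩ := Int.sq_of_isCoprime hc.symm hY'
  have he' : D = e ^ 2 := by
    rcases he with he | he
    · exact he
    · nlinarith [sq_nonneg e]
  have he0 : e ≠ 0 := by rintro rfl; simp at he'; omega
  refine ⟨⟨|e|, abs_pos.mpr he0, by rw [sq_abs]; exact he'⟩, ?_⟩
  have h4 : e ∣ Y := by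
    have : e ^ 2 ∣ Y ^ 2 := ⟨P, by rw [← hY', he']⟩
    exact (Int.pow_dvd_pow_iff (by norm_num)).mp this
  obtain ⟨Z, rfl⟩ := h4
  refine ⟨Z, mul_left_cancel₀ (pow_ne_zero 2 he0) ?_⟩
  rw [he'] at hY'; linear_combination hY'

lemma sq_of_mul_sq (P V Y : ℤ) (hV : V ≠ 0) (h : P * V ^ 2 = Y ^ 2) : ∃ r : ℤ, P = r ^ 2 := by
  have h4 : V ∣ Y := by
    have : V ^ 2 ∣ Y ^ 2 := ⟨P, by rw [← h]; ring⟩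
    exact (Int.pow_dvd_pow_iff (by norm_num)).mp this
  obtain ⟨Z, rfl⟩ := h4
  exact ⟨Z, mul_left_cancel₀ (pow_ne_zero 2 hV) (by linear_combination h)⟩

/-- candidate squarefree classes -/
def cand (K : ℤ) : List ℤ :=
  [1, 2, 3, 5, 6, 10, 15, 30, -1, -2, -3, -5, -6, -10, -15, -30].filter fun d => K % d == 0

lemma mem_cand (K d : ℤ) (hK : K ∣ 30 ^ 3) (hd : Squarefree d) (h : d ∣ K) : d ∈ cand K := by
  have h1 : d ∣ 30 := (hd.dvd_pow_iff_dvd (by norm_num)).mp (h.trans hK)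
  have h2 : K % d = 0 := Int.emod_eq_zero_of_dvd h
  have h3 : d ≤ 30 := Int.le_of_dvd (by norm_num) h1
  have h4 : -d ≤ 30 := Int.le_of_dvd (by norm_num) ((neg_dvd).mpr h1)
  unfold cand
  rw [List.mem_filter]
  refine ⟨?_, by simp [h2]⟩
  have h5 : -30 ≤ d := by linarith
  clear h h2 hd hK h4
  interval_cases d <;> first | (simp; done) | (exfalso; revert h1; decide)

/-- local test modulo `q` (a power of `p`): is there a primitive `(n, e)` mod `q` with
`n - a e² = d u²` solvable for all pairs `(a, d)` in the list. -/
def loc (p q : ℕ) (l : List (ℤ × ℤ)) : Bool :=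
  (List.range q).any fun n => (List.range q).any fun e =>
    !(Nat.beq (n % p) 0 && Nat.beq (e % p) 0) &&
      l.all fun ad => (List.range q).any fun u =>
        Nat.beq (((ad.2 % (q : ℤ)).toNat * (u * u) + (ad.1 % (q : ℤ)).toNat * (e * e)) % q) n

lemma loc_sound (p q : ℕ) (hpq : p ∣ q) (hq : 0 < q) (hp : 1 < p) (N e : ℤ) (hc : IsCoprime N e)
    (l : List (ℤ × ℤ)) (h : ∀ ad ∈ l, ∃ u : ℤ, N - ad.1 * e ^ 2 = ad.2 * u ^ 2) :
    loc p q l = true := by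
  have hq' : (0 : ℤ) < q := by exact_mod_cast hq
  have red : ∀ z : ℤ, ∃ n : ℕ, n < q ∧ ∃ k : ℤ, z = n + q * k := fun z => by
    refine ⟨(z % q).toNat, ?_, z / q, ?_⟩
    · have := Int.emod_lt_of_pos z hq'
      have := Int.emod_nonneg z hq'.ne'
      omega
    · rw [Int.toNat_of_nonneg (Int.emod_nonneg z hq'.ne')]
      exact (Int.emod_add_mul_ediv z q).symm
  obtain ⟨n, hn, k, hk⟩ := red N
  obtain ⟨f, hf, k', hk'⟩ := red e
  simp only [loc, List.any_eq_true, List.mem_range, Bool.and_eq_true, List.all_eq_true,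
    Bool.not_eq_true', Nat.beq_eq]
  refine ⟨n, hn, f, hf, ?_, ?_⟩
  · rw [Bool.eq_false_iff]
    intro hcon
    rw [Bool.and_eq_true, Nat.beq_eq, Nat.beq_eq] at hcon
    obtain ⟨h1, h2⟩ := hcon
    have d1 : (p : ℤ) ∣ N := by
      rw [hk]
      exact dvd_add (by exact_mod_cast Nat.dvd_of_mod_eq_zero h1)
        (Dvd.dvd.mul_right (by exact_mod_cast hpq) _)
    have d2 : (p : ℤ) ∣ e := by
      rw [hk']
      exact dvd_add (by exact_mod_cast Nat.dvd_of_mod_eq_zero h2)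
        (Dvd.dvd.mul_right (by exact_mod_cast hpq) _)
    have := hc.isUnit_of_dvd' d1 d2
    rw [Int.isUnit_iff] at this
    omega
  · intro ad had
    obtain ⟨u, hu⟩ := h ad had
    obtain ⟨v, hv, m, hm⟩ := red u
    refine ⟨v, hv, ?_⟩
    rw [hk, hk', hm] at hu
    have t1 := Int.toNat_of_nonneg (Int.emod_nonneg ad.2 hq'.ne')
    have t2 := Int.toNat_of_nonneg (Int.emod_nonneg ad.1 hq'.ne')
    have r1 := Int.emod_add_mul_ediv ad.2 q
    have r2 := Int.emod_add_mul_ediv ad.1 q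
    rw [← t1] at r1
    rw [← t2] at r2
    generalize (ad.2 % (q : ℤ)).toNat = D at *
    generalize (ad.1 % (q : ℤ)).toNat = A at *
    have hmod : D * (v * v) + A * (f * f) ≡ n [MOD q] := by
      rw [← Int.natCast_modEq_iff, Int.modEq_iff_dvd]
      refine ⟨-(k - ad.1 * (2 * f * k' + q * k' ^ 2) - ad.2 * (2 * v * m + q * m ^ 2)) +
        ad.2 / q * v ^ 2 + ad.1 / q * f ^ 2, ?_⟩
      push_cast
      linear_combination hu - (v : ℤ) ^ 2 * r1 - (f : ℤ) ^ 2 * r2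
    rw [hmod, Nat.mod_eq_of_lt hn]

/-- necessary condition to be a square (for ± products of 2, 3, 5) -/
def sqt (P : ℤ) : Bool :=
  decide (0 < P) && [0, 1, 2, 4].contains (P % 7) && [0, 1, 3, 4, 5, 9].contains (P % 11) &&
    [0, 1, 3, 4, 9, 10, 12].contains (P % 13)

lemma sqt_sound (P r : ℤ) (h : P = r ^ 2) (h0 : P ≠ 0) : sqt P = true := by
  have hpos : 0 < P := by
    rw [h]; rw [h] at h0; positivity
  have g7 : P % 7 ∈ [(0 : ℤ), 1, 2, 4] := by
    have : r % 7 = 0 ∨ r % 7 = 1 ∨ r % 7 = 2 ∨ r % 7 = 3 ∨ r % 7 = 4 ∨ r % 7 = 5 ∨ r % 7 = 6 := by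
      omega
    rw [h]
    rcases this with h | h | h | h | h | h | h <;> simp [pow_two, Int.mul_emod, h]
  have g11 : P % 11 ∈ [(0 : ℤ), 1, 3, 4, 5, 9] := by
    have : r % 11 = 0 ∨ r % 11 = 1 ∨ r % 11 = 2 ∨ r % 11 = 3 ∨ r % 11 = 4 ∨ r % 11 = 5 ∨
        r % 11 = 6 ∨ r % 11 = 7 ∨ r % 11 = 8 ∨ r % 11 = 9 ∨ r % 11 = 10 := by
      omega
    rw [h]
    rcases this with h | h | h | h | h | h | h | h | h | h | h <;>
      simp [pow_two, Int.mul_emod, h]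
  have g13 : P % 13 ∈ [(0 : ℤ), 1, 3, 4, 9, 10, 12] := by
    have : r % 13 = 0 ∨ r % 13 = 1 ∨ r % 13 = 2 ∨ r % 13 = 3 ∨ r % 13 = 4 ∨ r % 13 = 5 ∨
        r % 13 = 6 ∨ r % 13 = 7 ∨ r % 13 = 8 ∨ r % 13 = 9 ∨ r % 13 = 10 ∨ r % 13 = 11 ∨
        r % 13 = 12 := by
      omega
    rw [h]
    rcases this with h | h | h | h | h | h | h | h | h | h | h | h | h <;>
      simp [pow_two, Int.mul_emod, h]
  simp only [sqt, Bool.and_eq_true, decide_eq_true_eq, List.contains_iff_mem]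
  exact ⟨⟨⟨hpos, g7⟩, g11⟩, g13⟩

def pre (l : List (ℤ × ℤ)) : Bool := loc 2 2 l && loc 3 3 l && loc 5 5 l

def fin (l : List (ℤ × ℤ)) : Bool := loc 2 8 l && loc 3 9 l && loc 2 16 l

def table3 (A B : ℤ) : List (ℤ × ℤ × ℤ) :=
  (cand (A * B)).flatMap fun d1 => (cand (A * (B - A))).flatMap fun d2 =>
    if (decide (d1 < 0) || decide (0 < d2)) && pre [(0, d1), (-A, d2)] then
      (cand (B * (B - A))).filterMap fun d3 =>
        if (decide (d2 < 0) || decide (0 < d3)) && sqt (d1 * d2 * d3) &&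
            pre [(0, d1), (-A, d2), (-B, d3)] && fin [(0, d1), (-A, d2), (-B, d3)]
        then some (d1, d2, d3) else none
    else []

def table5 : List (ℤ × ℤ × ℤ × ℤ × ℤ) :=
  (cand 60).flatMap fun d1 => (cand 20).flatMap fun d2 =>
    if (decide (d2 < 0) || decide (0 < d1)) && pre [(0, d1), (1, d2)] then
      (cand 24).flatMap fun d3 =>
        if (decide (d3 < 0) || decide (0 < d2)) && pre [(0, d1), (1, d2), (2, d3)] then
          (cand 60).flatMap fun d4 =>
            if (decide (d4 < 0) || decide (0 < d3)) &&
                pre [(0, d1), (1, d2), (2, d3), (5, d4)] then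
              (cand 120).filterMap fun d5 =>
                if (decide (d5 < 0) || decide (0 < d4)) && sqt (d1 * d2 * d3 * d4 * d5) &&
                  pre [(0, d1), (1, d2), (2, d3), (5, d4), (6, d5)] &&
                  fin [(0, d1), (1, d2), (2, d3), (5, d4), (6, d5)]
                then some (d1, d2, d3, d4, d5) else none
            else []
        else []
    else []

lemma t45 : table3 4 5 = [(1, 1, 1), (5, 1, 5), (-1, -1, 1), (-5, -1, 5)] := by decide +kernel

lemma t59 : table3 5 9 = [(1, 1, 1), (5, 5, 1), (-1, -1, 1), (-5, -5, 1)] := by decide +kernel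

lemma t25 : table3 2 5 = [(1, 1, 1), (10, 2, 5), (-2, -6, 3), (-5, -3, 15)] := by decide +kernel

lemma t1215 : table3 12 15 = [(1, 1, 1), (5, 3, 15), (-3, -1, 3), (-15, -3, 5)] := by
  decide +kernel

lemma t5 : table5 = [(1, 1, 1, 1, 1), (1, -5, -1, -1, -5), (2, 1, 6, -3, -1), (3, 2, 1, -2, -3),
    (5, 1, 3, -15, -1), (6, 5, 1, 1, 30), (10, 1, 2, 5, 1), (15, -1, -2, -5, -6)] := by
  decide +kernel

end GG
namespace GG

lemma cop_shift (N e a : ℤ) (h : IsCoprime N e) : IsCoprime (N + a * e ^ 2) e := by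
  have h1 : N + a * e ^ 2 = N + a * e * e := by ring
  rw [h1]
  exact IsCoprime.add_mul_right_left_iff.mpr h

lemma dvd_of_dvd_mul_pow (d K N e : ℤ) (k : ℕ) (hc : IsCoprime N e) (hd : d ∣ N)
    (h : d ∣ K * e ^ k) : d ∣ K :=
  ((hc.of_isCoprime_of_dvd_left hd).pow_right).dvd_of_dvd_mul_right h

lemma sign_step (N M d f u v : ℤ) (hN : N = d * u ^ 2) (hM : M = f * v ^ 2) (hNM : N < M) : (decide (d < 0) || decide (0 < f)) = true := by
  simp only [Bool.or_eq_true, decide_eq_true_eq]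
  by_contra hcon
  push Not at hcon
  obtain ⟨h1, h2⟩ := hcon
  have h3 : 0 ≤ N := by rw [hN]; positivity
  have h4 : M ≤ 0 := by rw [hM]; nlinarith [sq_nonneg v]
  linarith

lemma pre_sound (N e : ℤ) (hc : IsCoprime N e)
    (l : List (ℤ × ℤ)) (h : ∀ ad ∈ l, ∃ u : ℤ, N - ad.1 * e ^ 2 = ad.2 * u ^ 2) :
    pre l = true := by
  simp only [pre, Bool.and_eq_true]
  exact ⟨⟨loc_sound _ _ (by norm_num) (by norm_num) (by norm_num) N e hc l h,
    loc_sound _ _ (by norm_num) (by norm_num) (by norm_num) N e hc l h⟩,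
    loc_sound _ _ (by norm_num) (by norm_num) (by norm_num) N e hc l h⟩

lemma fin_sound (N e : ℤ) (hc : IsCoprime N e)
    (l : List (ℤ × ℤ)) (h : ∀ ad ∈ l, ∃ u : ℤ, N - ad.1 * e ^ 2 = ad.2 * u ^ 2) :
    fin l = true := by
  simp only [fin, Bool.and_eq_true]
  exact ⟨⟨loc_sound _ _ (by norm_num) (by norm_num) (by norm_num) N e hc l h,
    loc_sound _ _ (by norm_num) (by norm_num) (by norm_num) N e hc l h⟩,
    loc_sound _ _ (by norm_num) (by norm_num) (by norm_num) N e hc l h⟩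

lemma rat_eq (x : ℚ) : x * (x.den : ℚ) = (x.num : ℚ) := Rat.mul_den_eq_num x

/-- 2-descent on `y² = x (x + A) (x + B)`. -/
lemma three (A B : ℤ) (hA : 0 < A) (hAB : A < B) (k1 : A * B ∣ 30 ^ 3)
    (k2 : A * (B - A) ∣ 30 ^ 3) (k3 : B * (B - A) ∣ 30 ^ 3) (x y : ℚ) (hy : y ≠ 0)
    (h : y ^ 2 = x * (x + A) * (x + B)) :
    ∃ d1 d2 d3 : ℤ, (d1, d2, d3) ∈ table3 A B ∧ ∃ u1 u2 u3 : ℚ,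
      x = d1 * u1 ^ 2 ∧ x + A = d2 * u2 ^ 2 ∧ x + B = d3 * u3 ^ 2 := by
  obtain ⟨N, D, hD, hcND, hx⟩ : ∃ N D : ℤ, 0 < D ∧ IsCoprime N D ∧ x * D = N := by
    refine ⟨x.num, x.den, by exact_mod_cast x.den_pos, ?_, by exact_mod_cast rat_eq x⟩
    exact Rat.isCoprime_num_den x
  have c2 : IsCoprime (N + A * D) D := IsCoprime.add_mul_right_left_iff.mpr hcND
  have c3 : IsCoprime (N + B * D) D := IsCoprime.add_mul_right_left_iff.mpr hcND
  obtain ⟨⟨e, he, rfl⟩, Y, hY⟩ := den_sq (N * (N + A * D) * (N + B * D)) D (y * D ^ 2) hD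
    ((hcND.mul_left c2).mul_left c3) (by
      push_cast
      rw [← hx, mul_pow, h]; ring)
  have hc : IsCoprime N e := (IsCoprime.pow_right_iff (by norm_num)).mp hcND
  have heQ : (e : ℚ) ≠ 0 := by exact_mod_cast he.ne'
  have hY0 : Y ≠ 0 := by
    rintro rfl
    have : ((N * (N + A * e ^ 2) * (N + B * e ^ 2) : ℤ) : ℚ) = 0 := by rw [hY]; simp
    push_cast at this hx
    rw [← hx] at this
    have h2 : y ^ 2 * (e : ℚ) ^ 6 = 0 := by rw [h, ← this]; ring
    rcases mul_eq_zero.mp h2 with h2 | h2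
    · exact hy (by simpa using h2)
    · exact heQ (by simpa using h2)
  have hne : N * (N + A * e ^ 2) * (N + B * e ^ 2) ≠ 0 := by rw [hY]; positivity
  have n1 : N ≠ 0 := fun h0 => hne (by rw [h0]; ring)
  have n2 : N + A * e ^ 2 ≠ 0 := fun h0 => hne (by rw [h0]; ring)
  have n3 : N + B * e ^ 2 ≠ 0 := fun h0 => hne (by rw [h0]; ring)
  obtain ⟨d1, u1, e1, v1, s1⟩ := exists_sf N ((N + A * e ^ 2) * (N + B * e ^ 2)) Y n1
    (by linear_combination hY)
  obtain ⟨d2, u2, e2, v2, s2⟩ := exists_sf (N + A * e ^ 2) (N * (N + B * e ^ 2)) Y n2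
    (by linear_combination hY)
  obtain ⟨d3, u3, e3, v3, s3⟩ := exists_sf (N + B * e ^ 2) (N * (N + A * e ^ 2)) Y n3
    (by linear_combination hY)
  have w1 : d1 ∣ N := ⟨u1 ^ 2, e1⟩
  have w2 : d2 ∣ N + A * e ^ 2 := ⟨u2 ^ 2, e2⟩
  have w3 : d3 ∣ N + B * e ^ 2 := ⟨u3 ^ 2, e3⟩
  have m1 : d1 ∈ cand (A * B) := mem_cand _ _ k1 s1 <|
    dvd_of_dvd_mul_pow d1 _ N e 4 hc w1 (by
      obtain ⟨c, hc'⟩ := dvd_sub v1 (Dvd.dvd.mul_right w1 (N + A * e ^ 2 + B * e ^ 2))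
      exact ⟨c, by linear_combination hc'⟩)
  have m2 : d2 ∈ cand (A * (B - A)) := mem_cand _ _ k2 s2 <|
    dvd_of_dvd_mul_pow d2 _ _ e 4 (cop_shift N e A hc) w2 (by
      obtain ⟨c, hc'⟩ := dvd_sub (Dvd.dvd.mul_right w2 (N + (B - A) * e ^ 2)) v2
      exact ⟨c, by linear_combination hc'⟩)
  have m3 : d3 ∈ cand (B * (B - A)) := mem_cand _ _ k3 s3 <|
    dvd_of_dvd_mul_pow d3 _ _ e 4 (cop_shift N e B hc) w3 (by
      obtain ⟨c, hc'⟩ := dvd_sub v3 (Dvd.dvd.mul_right w3 (N + (A - B) * e ^ 2))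
      exact ⟨c, by linear_combination hc'⟩)
  have he2 : 0 < e ^ 2 := by positivity
  have sg1 := sign_step _ _ d1 d2 u1 u2 e1 e2 (by nlinarith)
  have sg2 := sign_step _ _ d2 d3 u2 u3 e2 e3 (by nlinarith)
  have z1 : u1 ≠ 0 := by rintro rfl; simp at e1; exact n1 e1
  have z2 : u2 ≠ 0 := by rintro rfl; simp at e2; exact n2 e2
  have z3 : u3 ≠ 0 := by rintro rfl; simp at e3; exact n3 e3
  obtain ⟨r, hr⟩ := sq_of_mul_sq (d1 * d2 * d3) (u1 * u2 * u3) Y (by positivity) (by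
    rw [← hY, e2, e3]; nth_rewrite 1 [e1]; ring)
  have sq := sqt_sound _ r hr (mul_ne_zero (mul_ne_zero s1.ne_zero s2.ne_zero) s3.ne_zero)
  have g2 : ∀ ad ∈ [((0 : ℤ), d1), (-A, d2)], ∃ u : ℤ, N - ad.1 * e ^ 2 = ad.2 * u ^ 2 := by
    simp only [List.mem_cons, List.not_mem_nil, or_false, forall_eq_or_imp, forall_eq]
    exact ⟨⟨u1, by linear_combination e1⟩, ⟨u2, by linear_combination e2⟩⟩
  have g3 : ∀ ad ∈ [((0 : ℤ), d1), (-A, d2), (-B, d3)],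
      ∃ u : ℤ, N - ad.1 * e ^ 2 = ad.2 * u ^ 2 := by
    simp only [List.mem_cons, List.not_mem_nil, or_false, forall_eq_or_imp, forall_eq]
    exact ⟨⟨u1, by linear_combination e1⟩, ⟨u2, by linear_combination e2⟩,
      ⟨u3, by linear_combination e3⟩⟩
  refine ⟨d1, d2, d3, ?_, u1 / e, u2 / e, u3 / e, ?_, ?_, ?_⟩
  · unfold table3
    rw [List.mem_flatMap]
    refine ⟨d1, m1, ?_⟩
    rw [List.mem_flatMap]
    refine ⟨d2, m2, ?_⟩
    rw [pre_sound N e hc _ g2, sg1]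
    simp only [Bool.and_self, if_true]
    rw [List.mem_filterMap]
    refine ⟨d3, m3, ?_⟩
    rw [pre_sound N e hc _ g3, fin_sound N e hc _ g3, sg2, sq]
    simp
  all_goals
    push_cast at hx
    field_simp
  · have := congrArg (Int.cast : ℤ → ℚ) e1
    push_cast at this
    linear_combination hx + this
  · have := congrArg (Int.cast : ℤ → ℚ) e2
    push_cast at this
    linear_combination hx + this
  · have := congrArg (Int.cast : ℤ → ℚ) e3
    push_cast at this
    linear_combination hx + this

end GG
namespace GG

/-- a square rational whose `q²`-multiple is an integer -/
lemma int_of_sq (z : ℚ) (k : ℤ) (h : z ^ 2 = k) : ∃ s : ℤ, z = s := by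
  have h1 : IsSquare ((k : ℤ) : ℚ) := ⟨z, by rw [← h]; ring⟩
  rw [Rat.isSquare_intCast_iff] at h1
  obtain ⟨s, hs⟩ := h1
  have : z ^ 2 = (s : ℚ) ^ 2 := by rw [h, hs]; push_cast; ring
  rcases sq_eq_sq_iff_eq_or_eq_neg.mp this with h2 | h2
  · exact ⟨s, h2⟩
  · exact ⟨-s, by rw [h2]; push_cast; ring⟩

/-- Infinite descent for `y² = x (x + A) (x + B)`. -/
theorem descent (A B : ℤ) (hA : 0 < A) (hAB : A < B)
    (hcon : ∀ x y : ℚ, y ≠ 0 → y ^ 2 = x * (x + A) * (x + B) →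
      ∃ ρ σ ω : ℚ, ρ ≠ 0 ∧ ρ ^ 2 + A = σ ^ 2 ∧ ρ ^ 2 + B = ω ^ 2 ∧
        (x ^ 2 - A * B) ^ 2 * (ρ * σ * ω) ^ 2 = y ^ 2 * (ρ ^ 4 - A * B) ^ 2)
    (hsmall : ∀ p q s w : ℤ, 0 < q → p ≠ 0 → IsCoprime p q → p ^ 2 + A * q ^ 2 = s ^ 2 →
      p ^ 2 + B * q ^ 2 = w ^ 2 → s ∣ p ^ 4 - A * B * q ^ 4 → False)
    (x y : ℚ) (h : y ^ 2 = x * (x + A) * (x + B)) : y = 0 := by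
  have hAQ : (0 : ℚ) < A := by exact_mod_cast hA
  have hABQ : (A : ℚ) < B := by exact_mod_cast hAB
  have main : ∀ n : ℕ, ∀ ρ σ ω : ℚ, ρ.den = n → ρ ≠ 0 → ρ ^ 2 + A = σ ^ 2 →
      ρ ^ 2 + B = ω ^ 2 → False := by
    intro n
    induction n using Nat.strong_induction_on with
    | _ n ih =>
    intro ρ σ ω hn h0 hσ hω
    have n1 : ρ + σ ≠ 0 := by
      intro hz
      have : (σ - ρ) * (ρ + σ) = A := by linear_combination -hσ
      rw [hz] at this; linarith
    have n2 : ρ + ω ≠ 0 := by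
      intro hz
      have : (ω - ρ) * (ρ + ω) = B := by linear_combination -hω
      rw [hz] at this; linarith
    have n3 : σ + ω ≠ 0 := by
      intro hz
      have : (ω - σ) * (σ + ω) = B - A := by linear_combination hσ - hω
      rw [hz] at this; linarith
    have hy0 : (ρ + σ) * (ρ + ω) * (σ + ω) ≠ 0 := mul_ne_zero (mul_ne_zero n1 n2) n3
    have hA' : (A : ℚ) = σ ^ 2 - ρ ^ 2 := by linear_combination hσ
    have hB' : (B : ℚ) = ω ^ 2 - ρ ^ 2 := by linear_combination hω
    obtain ⟨ρ', σ', ω', h0', hσ', hω', hd⟩ := hcon ((ρ + σ) * (ρ + ω))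
      ((ρ + σ) * (ρ + ω) * (σ + ω)) hy0 (by rw [hA', hB']; ring)
    have hd2 : (2 * ρ * (ρ' * σ' * ω')) ^ 2 = (ρ' ^ 4 - A * B) ^ 2 := by
      have e1 : ((ρ + σ) * (ρ + ω)) ^ 2 - (A : ℚ) * B =
          2 * ρ * ((ρ + σ) * (ρ + ω) * (σ + ω)) := by rw [hA', hB']; ring
      rw [e1] at hd
      refine mul_left_cancel₀ (pow_ne_zero 2 hy0) ?_
      linear_combination hd
    obtain ⟨p, q, hq, hpq, hρ', hqd⟩ : ∃ p q : ℤ, 0 < q ∧ IsCoprime p q ∧ ρ' * q = p ∧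
        q = ρ'.den :=
      ⟨ρ'.num, ρ'.den, by exact_mod_cast ρ'.den_pos, Rat.isCoprime_num_den ρ',
        by exact_mod_cast rat_eq ρ', rfl⟩
    obtain ⟨R, t, ht, hRt, hρ, htd⟩ : ∃ p q : ℤ, 0 < q ∧ IsCoprime p q ∧ ρ * q = p ∧
        q = ρ.den :=
      ⟨ρ.num, ρ.den, by exact_mod_cast ρ.den_pos, Rat.isCoprime_num_den ρ,
        by exact_mod_cast rat_eq ρ, rfl⟩
    have hqQ : (q : ℚ) ≠ 0 := by exact_mod_cast hq.ne'
    obtain ⟨s, hs⟩ := int_of_sq (σ' * q) (p ^ 2 + A * q ^ 2) (by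
      push_cast; rw [← hρ', mul_pow, ← hσ']; ring)
    obtain ⟨w, hw⟩ := int_of_sq (ω' * q) (p ^ 2 + B * q ^ 2) (by
      push_cast; rw [← hρ', mul_pow, ← hω']; ring)
    have hs2 : p ^ 2 + A * q ^ 2 = s ^ 2 := by
      have : ((p ^ 2 + A * q ^ 2 : ℤ) : ℚ) = ((s ^ 2 : ℤ) : ℚ) := by
        push_cast; rw [← hρ', ← hs]; linear_combination (q : ℚ) ^ 2 * hσ'
      exact_mod_cast this
    have hw2 : p ^ 2 + B * q ^ 2 = w ^ 2 := by
      have : ((p ^ 2 + B * q ^ 2 : ℤ) : ℚ) = ((w ^ 2 : ℤ) : ℚ) := by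
        push_cast; rw [← hρ', ← hw]; linear_combination (q : ℚ) ^ 2 * hω'
      exact_mod_cast this
    have key : (R * (2 * p * s * w) * q) ^ 2 = (t * (p ^ 4 - A * B * q ^ 4)) ^ 2 := by
      have : (((R * (2 * p * s * w) * q) ^ 2 : ℤ) : ℚ) =
          (((t * (p ^ 4 - A * B * q ^ 4)) ^ 2 : ℤ) : ℚ) := by
        push_cast
        rw [← hρ, ← hρ', ← hs, ← hw]
        linear_combination (t : ℚ) ^ 2 * (q : ℚ) ^ 8 * hd2
      exact_mod_cast this
    have hp0 : p ≠ 0 := by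
      rintro rfl
      simp only [Int.cast_zero, mul_eq_zero] at hρ'
      tauto
    have hcq : IsCoprime q (p ^ 4 - A * B * q ^ 4) := by
      have h1 : p ^ 4 - A * B * q ^ 4 = p ^ 4 + q * (-(A * B * q ^ 3)) := by ring
      rw [h1]
      exact IsCoprime.add_mul_left_right_iff.mpr hpq.symm.pow_right
    have hqt : q ∣ t := by
      have h1 : q ^ 2 ∣ (t * (p ^ 4 - A * B * q ^ 4)) ^ 2 := by
        rw [← key, mul_pow]; exact Dvd.intro_left _ rfl
      exact hcq.dvd_of_dvd_mul_right ((Int.pow_dvd_pow_iff (by norm_num)).mp h1)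
    have hle : q ≤ t := Int.le_of_dvd ht hqt
    rcases hle.lt_or_eq with hlt | heq
    · exact ih ρ'.den (by rw [← hn]; omega) ρ' σ' ω' rfl h0' hσ' hω'
    · refine hsmall p q s w hq hp0 hpq hs2 hw2 ?_
      rw [← heq] at key
      have k2 : (p ^ 4 - A * B * q ^ 4) ^ 2 = (R * (2 * p * s * w)) ^ 2 :=
        mul_left_cancel₀ (pow_ne_zero 2 hq.ne') (by linear_combination -key)
      have k3 : s ^ 2 ∣ (p ^ 4 - A * B * q ^ 4) ^ 2 := by
        rw [k2]; exact ⟨(R * (2 * p * w)) ^ 2, by ring⟩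
      exact (Int.pow_dvd_pow_iff (by norm_num)).mp k3
  by_contra hy
  obtain ⟨ρ, σ, ω, h0, hσ, hω, -⟩ := hcon x y hy h
  exact main _ ρ σ ω rfl h0 hσ hω

/-- duplication is invariant under translation by two-torsion -/
lemma trans0 (A B x y ρ σ ω : ℚ) (_hy : y ≠ 0) (h : y ^ 2 = x * (x + A) * (x + B))
    (hσ : ρ ^ 2 + A = σ ^ 2) (hω : ρ ^ 2 + B = ω ^ 2) (hx : ρ ^ 2 = x) :
    (x ^ 2 - A * B) ^ 2 * (ρ * σ * ω) ^ 2 = y ^ 2 * (ρ ^ 4 - A * B) ^ 2 := by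
  have : ρ ^ 4 = x ^ 2 := by rw [← hx]; ring
  rw [this, mul_pow, mul_pow, ← hσ, ← hω, hx, h]; ring

lemma trans1 (A B x y ρ σ ω : ℚ) (hy : y ≠ 0) (h : y ^ 2 = x * (x + A) * (x + B))
    (hσ : ρ ^ 2 + A = σ ^ 2) (hω : ρ ^ 2 + B = ω ^ 2) (hx : ρ ^ 2 = A * B / x) :
    (x ^ 2 - A * B) ^ 2 * (ρ * σ * ω) ^ 2 = y ^ 2 * (ρ ^ 4 - A * B) ^ 2 := by
  have h1 : x ≠ 0 := by rintro rfl; apply hy; simpa using h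
  have : ρ ^ 4 = (A * B / x) ^ 2 := by rw [← hx]; ring
  rw [this, mul_pow, mul_pow, ← hσ, ← hω, hx, h]
  field_simp
  ring

lemma trans2 (A B x y ρ σ ω : ℚ) (hy : y ≠ 0) (h : y ^ 2 = x * (x + A) * (x + B))
    (hσ : ρ ^ 2 + A = σ ^ 2) (hω : ρ ^ 2 + B = ω ^ 2) (hx : ρ ^ 2 = -A * (x + B) / (x + A)) :
    (x ^ 2 - A * B) ^ 2 * (ρ * σ * ω) ^ 2 = y ^ 2 * (ρ ^ 4 - A * B) ^ 2 := by
  have h1 : x + A ≠ 0 := by intro h0; apply hy; rw [h0] at h; simpa using h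
  have : ρ ^ 4 = (-A * (x + B) / (x + A)) ^ 2 := by rw [← hx]; ring
  rw [this, mul_pow, mul_pow, ← hσ, ← hω, hx, h]
  field_simp
  ring

lemma trans3 (A B x y ρ σ ω : ℚ) (hy : y ≠ 0) (h : y ^ 2 = x * (x + A) * (x + B))
    (hσ : ρ ^ 2 + A = σ ^ 2) (hω : ρ ^ 2 + B = ω ^ 2) (hx : ρ ^ 2 = -B * (x + A) / (x + B)) :
    (x ^ 2 - A * B) ^ 2 * (ρ * σ * ω) ^ 2 = y ^ 2 * (ρ ^ 4 - A * B) ^ 2 := by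
  have := trans2 B A x y ρ ω σ hy (by rw [h]; ring) hω hσ hx
  linear_combination this

/-- The four classes of two-torsion points, translated to the trivial class. Here
`a, b, c` are the square roots of the relevant rational constants. -/
lemma con0 (A B x y u v w : ℚ) (hy : y ≠ 0) (h : y ^ 2 = x * (x + A) * (x + B))
    (h1 : x = u ^ 2) (h2 : x + A = v ^ 2) (h3 : x + B = w ^ 2) :
    ∃ ρ σ ω : ℚ, ρ ≠ 0 ∧ ρ ^ 2 + A = σ ^ 2 ∧ ρ ^ 2 + B = ω ^ 2 ∧
        (x ^ 2 - A * B) ^ 2 * (ρ * σ * ω) ^ 2 = y ^ 2 * (ρ ^ 4 - A * B) ^ 2 := by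
  refine ⟨u, v, w, ?_, by rw [← h1, h2], by rw [← h1, h3],
    trans0 A B x y u v w hy h (by rw [← h1, h2]) (by rw [← h1, h3]) h1.symm⟩
  rintro rfl; apply hy; rw [h1] at h; simpa using h

lemma con1 (A B x y u v w d f g a b c : ℚ) (hy : y ≠ 0) (h : y ^ 2 = x * (x + A) * (x + B))
    (h1 : x = d * u ^ 2) (h2 : x + A = f * v ^ 2) (h3 : x + B = g * w ^ 2) (ha0 : a ≠ 0)
    (ha : A * B = d * a ^ 2) (hb : A * g = d * b ^ 2) (hc : B * f = d * c ^ 2) :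
    ∃ ρ σ ω : ℚ, ρ ≠ 0 ∧ ρ ^ 2 + A = σ ^ 2 ∧ ρ ^ 2 + B = ω ^ 2 ∧
        (x ^ 2 - A * B) ^ 2 * (ρ * σ * ω) ^ 2 = y ^ 2 * (ρ ^ 4 - A * B) ^ 2 := by
  have hx : x ≠ 0 := by rintro rfl; apply hy; simpa using h
  have hd : d ≠ 0 := by rintro rfl; apply hx; rw [h1]; ring
  have hu : u ≠ 0 := by rintro rfl; apply hx; rw [h1]; ring
  have e1 : (a / u) ^ 2 = A * B / x := by
    rw [ha, h1]; field_simp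
  have e2 : (a / u) ^ 2 + A = (b * w / u) ^ 2 := by
    have : A * B / x + A = A * (x + B) / x := by field_simp; ring
    rw [e1, this, h3, ← mul_assoc, hb, h1]; field_simp
  have e3 : (a / u) ^ 2 + B = (c * v / u) ^ 2 := by
    have : A * B / x + B = B * (x + A) / x := by field_simp; ring
    rw [e1, this, h2, ← mul_assoc, hc, h1]; field_simp
  exact ⟨_, _, _, div_ne_zero ha0 hu, e2, e3, trans1 A B x y _ _ _ hy h e2 e3 e1⟩

lemma con2 (A B x y u v w d f g a b c : ℚ) (hy : y ≠ 0) (h : y ^ 2 = x * (x + A) * (x + B))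
    (h1 : x = d * u ^ 2) (h2 : x + A = f * v ^ 2) (h3 : x + B = g * w ^ 2) (ha0 : a ≠ 0)
    (ha : -A * g = f * a ^ 2) (hb : A * (A - B) = f * b ^ 2) (hc : (B - A) * d = f * c ^ 2) :
    ∃ ρ σ ω : ℚ, ρ ≠ 0 ∧ ρ ^ 2 + A = σ ^ 2 ∧ ρ ^ 2 + B = ω ^ 2 ∧
        (x ^ 2 - A * B) ^ 2 * (ρ * σ * ω) ^ 2 = y ^ 2 * (ρ ^ 4 - A * B) ^ 2 := by
  have hx : x + A ≠ 0 := by intro h0; apply hy; rw [h0] at h; simpa using h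
  have hxB : x + B ≠ 0 := by intro h0; apply hy; rw [h0] at h; simpa using h
  have hd : f ≠ 0 := by rintro rfl; apply hx; rw [h2]; ring
  have hv : v ≠ 0 := by rintro rfl; apply hx; rw [h2]; ring
  have hw : w ≠ 0 := by rintro rfl; apply hxB; rw [h3]; ring
  have e1 : (a * w / v) ^ 2 = -A * (x + B) / (x + A) := by
    rw [h3, ← mul_assoc, ha, h2]; field_simp
  have e2 : (a * w / v) ^ 2 + A = (b / v) ^ 2 := by
    have : -A * (x + B) / (x + A) + A = A * (A - B) / (x + A) := by field_simp; ring
    rw [e1, this, hb, h2]; field_simp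
  have e3 : (a * w / v) ^ 2 + B = (c * u / v) ^ 2 := by
    have : -A * (x + B) / (x + A) + B = (B - A) * x / (x + A) := by field_simp; ring
    rw [e1, this, h1, ← mul_assoc, hc, ← h1, h2]; field_simp
  exact ⟨_, _, _, div_ne_zero (mul_ne_zero ha0 hw) hv, e2, e3,
    trans2 A B x y _ _ _ hy h e2 e3 e1⟩

lemma con3 (A B x y u v w d f g a b c : ℚ) (hy : y ≠ 0) (h : y ^ 2 = x * (x + A) * (x + B))
    (h1 : x = d * u ^ 2) (h2 : x + A = f * v ^ 2) (h3 : x + B = g * w ^ 2) (ha0 : a ≠ 0)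
    (ha : -B * f = g * a ^ 2) (hb : B * (B - A) = g * b ^ 2) (hc : (A - B) * d = g * c ^ 2) :
    ∃ ρ σ ω : ℚ, ρ ≠ 0 ∧ ρ ^ 2 + A = σ ^ 2 ∧ ρ ^ 2 + B = ω ^ 2 ∧
        (x ^ 2 - A * B) ^ 2 * (ρ * σ * ω) ^ 2 = y ^ 2 * (ρ ^ 4 - A * B) ^ 2 := by
  obtain ⟨ρ, σ, ω, h0, h4, h5, h6⟩ := con2 B A x y u w v d g f a b c hy (by rw [h]; ring)
    h1 h3 h2 ha0 ha hb hc
  exact ⟨ρ, ω, σ, h0, h5, h4, by linear_combination h6⟩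

lemma small (A B m : ℤ) (hA : 0 < A) (hm : A * (B - A) = m) (hm0 : 0 < m)
    (hdec : ∀ s ∈ Finset.Icc 1 m, s ∣ m → ∀ q ∈ Finset.Icc 1 m, ∀ p ∈ Finset.Icc 1 m,
      p ^ 2 + A * q ^ 2 = s ^ 2 → (p ^ 2 + B * q ^ 2) % 16 ∉ [(0 : ℤ), 1, 4, 9] ∨
      (p ^ 2 + B * q ^ 2) % 11 ∉ [(0 : ℤ), 1, 3, 4, 5, 9] ∨ (p ^ 2 + B * q ^ 2) % 5 ∉ [(0 : ℤ), 1, 4]) :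
    ∀ p q s w : ℤ, 0 < q → p ≠ 0 → IsCoprime p q → p ^ 2 + A * q ^ 2 = s ^ 2 →
      p ^ 2 + B * q ^ 2 = w ^ 2 → s ∣ p ^ 4 - A * B * q ^ 4 → False := by
  intro p q s w hq hp hc hs hw hd
  have hcs : IsCoprime s q := by
    have h1 : IsCoprime (p ^ 2 + A * q ^ 2) q := by
      have h2 : p ^ 2 + A * q ^ 2 = p ^ 2 + A * q * q := by ring
      rw [h2]; exact IsCoprime.add_mul_right_left_iff.mpr hc.pow_left
    rw [hs] at h1
    exact (IsCoprime.pow_left_iff (by norm_num)).mp h1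
  have hsm : s ∣ m := by
    have h1 : s ∣ m * q ^ 4 := by
      obtain ⟨c, hc⟩ := hd
      refine ⟨s * (s ^ 2 - 2 * A * q ^ 2) - c, ?_⟩
      have : p ^ 4 = (s ^ 2 - A * q ^ 2) ^ 2 := by rw [← hs]; ring
      rw [← hm]; linear_combination -hc + this
    exact (hcs.pow_right).dvd_of_dvd_mul_right h1
  have hs' : |s| ∣ m := (abs_dvd _ _).mpr hsm
  have hsle : |s| ≤ m := Int.le_of_dvd hm0 hs'
  have hp1 : 1 ≤ |p| := Int.one_le_abs hp
  have hAq : q ^ 2 ≤ A * q ^ 2 := by nlinarith [sq_nonneg q]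
  have hs2 : |p| ^ 2 + A * q ^ 2 = |s| ^ 2 := by rw [sq_abs, sq_abs]; exact hs
  have hs1 : 1 ≤ |s| := by
    by_contra hcon
    have : |s| = 0 := by have := abs_nonneg s; omega
    rw [this] at hs2; nlinarith
  have hqs : q ≤ |s| := by nlinarith
  have hps : |p| ≤ |s| := by nlinarith
  have := hdec |s| (Finset.mem_Icc.mpr ⟨hs1, hsle⟩) hs' q (Finset.mem_Icc.mpr ⟨hq, by linarith⟩)
    |p| (Finset.mem_Icc.mpr ⟨hp1, by linarith⟩) hs2
  rw [sq_abs, hw] at this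
  rcases this with h | h | h
  · apply h
    have : w % 16 = 0 ∨ w % 16 = 1 ∨ w % 16 = 2 ∨ w % 16 = 3 ∨ w % 16 = 4 ∨ w % 16 = 5 ∨
      w % 16 = 6 ∨ w % 16 = 7 ∨ w % 16 = 8 ∨ w % 16 = 9 ∨ w % 16 = 10 ∨ w % 16 = 11 ∨
      w % 16 = 12 ∨ w % 16 = 13 ∨ w % 16 = 14 ∨ w % 16 = 15 := by omega
    rcases this with h | h | h | h | h | h | h | h | h | h | h | h | h | h | h | h <;>
      simp [pow_two, Int.mul_emod, h]
  · apply h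
    have : w % 11 = 0 ∨ w % 11 = 1 ∨ w % 11 = 2 ∨ w % 11 = 3 ∨ w % 11 = 4 ∨ w % 11 = 5 ∨
      w % 11 = 6 ∨ w % 11 = 7 ∨ w % 11 = 8 ∨ w % 11 = 9 ∨ w % 11 = 10 := by omega
    rcases this with h | h | h | h | h | h | h | h | h | h | h <;>
      simp [pow_two, Int.mul_emod, h]
  · apply h
    have : w % 5 = 0 ∨ w % 5 = 1 ∨ w % 5 = 2 ∨ w % 5 = 3 ∨ w % 5 = 4 := by omega
    rcases this with h | h | h | h | h <;> simp [pow_two, Int.mul_emod, h]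

lemma small45 : ∀ p q s w : ℤ, 0 < q → p ≠ 0 → IsCoprime p q → p ^ 2 + 4 * q ^ 2 = s ^ 2 →
    p ^ 2 + 5 * q ^ 2 = w ^ 2 → s ∣ p ^ 4 - 4 * 5 * q ^ 4 → False :=
  small 4 5 4 (by norm_num) (by norm_num) (by norm_num) (by decide +kernel)

lemma small59 : ∀ p q s w : ℤ, 0 < q → p ≠ 0 → IsCoprime p q → p ^ 2 + 5 * q ^ 2 = s ^ 2 →
    p ^ 2 + 9 * q ^ 2 = w ^ 2 → s ∣ p ^ 4 - 5 * 9 * q ^ 4 → False :=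
  small 5 9 20 (by norm_num) (by norm_num) (by norm_num) (by decide +kernel)

lemma small25 : ∀ p q s w : ℤ, 0 < q → p ≠ 0 → IsCoprime p q → p ^ 2 + 2 * q ^ 2 = s ^ 2 →
    p ^ 2 + 5 * q ^ 2 = w ^ 2 → s ∣ p ^ 4 - 2 * 5 * q ^ 4 → False :=
  small 2 5 6 (by norm_num) (by norm_num) (by norm_num) (by decide +kernel)

lemma small1215 : ∀ p q s w : ℤ, 0 < q → p ≠ 0 → IsCoprime p q → p ^ 2 + 12 * q ^ 2 = s ^ 2 →
    p ^ 2 + 15 * q ^ 2 = w ^ 2 → s ∣ p ^ 4 - 12 * 15 * q ^ 4 → False :=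
  small 12 15 36 (by norm_num) (by norm_num) (by norm_num) (by decide +kernel)

theorem curve45 (x y : ℚ) (h : y ^ 2 = x * (x + 4) * (x + 5)) : y = 0 := by
  refine descent 4 5 (by norm_num) (by norm_num) ?_ small45 x y (by push_cast; exact h)
  clear h x y
  intro x y hy h
  obtain ⟨d1, d2, d3, hm, u, v, w, h1, h2, h3⟩ := three 4 5 (by norm_num) (by norm_num)
    (by norm_num) (by norm_num) (by norm_num) x y hy h
  rw [t45] at hm
  simp only [List.mem_cons, Prod.mk.injEq, List.not_mem_nil, or_false] at hm
  rcases hm with ⟨rfl, rfl, rfl⟩ | ⟨rfl, rfl, rfl⟩ | ⟨rfl, rfl, rfl⟩ | ⟨rfl, rfl, rfl⟩ <;>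
    push_cast at h h1 h2 h3 ⊢
  · exact con0 _ _ x y u v w hy h (by linarith) (by linarith) (by linarith)
  · exact con1 _ _ x y u v w _ _ _ 2 2 1 hy h h1 h2 h3 (by norm_num) (by norm_num)
      (by norm_num) (by norm_num)
  · exact con2 _ _ x y u v w _ _ _ 2 2 1 hy h h1 h2 h3 (by norm_num) (by norm_num)
      (by norm_num) (by norm_num)
  · exact con3 _ _ x y u v w _ _ _ 1 1 1 hy h h1 h2 h3 (by norm_num) (by norm_num)
      (by norm_num) (by norm_num)

theorem curve59 (x y : ℚ) (h : y ^ 2 = x * (x + 5) * (x + 9)) : y = 0 := by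
  refine descent 5 9 (by norm_num) (by norm_num) ?_ small59 x y (by push_cast; exact h)
  clear h x y
  intro x y hy h
  obtain ⟨d1, d2, d3, hm, u, v, w, h1, h2, h3⟩ := three 5 9 (by norm_num) (by norm_num)
    (by norm_num) (by norm_num) (by norm_num) x y hy h
  rw [t59] at hm
  simp only [List.mem_cons, Prod.mk.injEq, List.not_mem_nil, or_false] at hm
  rcases hm with ⟨rfl, rfl, rfl⟩ | ⟨rfl, rfl, rfl⟩ | ⟨rfl, rfl, rfl⟩ | ⟨rfl, rfl, rfl⟩ <;>
    push_cast at h h1 h2 h3 ⊢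
  · exact con0 _ _ x y u v w hy h (by linarith) (by linarith) (by linarith)
  · exact con1 _ _ x y u v w _ _ _ 3 1 3 hy h h1 h2 h3 (by norm_num) (by norm_num)
      (by norm_num) (by norm_num)
  · exact con3 _ _ x y u v w _ _ _ 3 6 2 hy h h1 h2 h3 (by norm_num) (by norm_num)
      (by norm_num) (by norm_num)
  · exact con2 _ _ x y u v w _ _ _ 1 2 2 hy h h1 h2 h3 (by norm_num) (by norm_num)
      (by norm_num) (by norm_num)

theorem curve25 (x y : ℚ) (h : y ^ 2 = x * (x + 2) * (x + 5)) : y = 0 := by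
  refine descent 2 5 (by norm_num) (by norm_num) ?_ small25 x y (by push_cast; exact h)
  clear h x y
  intro x y hy h
  obtain ⟨d1, d2, d3, hm, u, v, w, h1, h2, h3⟩ := three 2 5 (by norm_num) (by norm_num)
    (by norm_num) (by norm_num) (by norm_num) x y hy h
  rw [t25] at hm
  simp only [List.mem_cons, Prod.mk.injEq, List.not_mem_nil, or_false] at hm
  rcases hm with ⟨rfl, rfl, rfl⟩ | ⟨rfl, rfl, rfl⟩ | ⟨rfl, rfl, rfl⟩ | ⟨rfl, rfl, rfl⟩ <;>
    push_cast at h h1 h2 h3 ⊢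
  · exact con0 _ _ x y u v w hy h (by linarith) (by linarith) (by linarith)
  · exact con1 _ _ x y u v w _ _ _ 1 1 1 hy h h1 h2 h3 (by norm_num) (by norm_num)
      (by norm_num) (by norm_num)
  · exact con2 _ _ x y u v w _ _ _ 1 1 1 hy h h1 h2 h3 (by norm_num) (by norm_num)
      (by norm_num) (by norm_num)
  · exact con3 _ _ x y u v w _ _ _ 1 1 1 hy h h1 h2 h3 (by norm_num) (by norm_num)
      (by norm_num) (by norm_num)

theorem curve1215 (x y : ℚ) (h : y ^ 2 = x * (x + 12) * (x + 15)) : y = 0 := by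
  refine descent 12 15 (by norm_num) (by norm_num) ?_ small1215 x y (by push_cast; exact h)
  clear h x y
  intro x y hy h
  obtain ⟨d1, d2, d3, hm, u, v, w, h1, h2, h3⟩ := three 12 15 (by norm_num) (by norm_num)
    (by norm_num) (by norm_num) (by norm_num) x y hy h
  rw [t1215] at hm
  simp only [List.mem_cons, Prod.mk.injEq, List.not_mem_nil, or_false] at hm
  rcases hm with ⟨rfl, rfl, rfl⟩ | ⟨rfl, rfl, rfl⟩ | ⟨rfl, rfl, rfl⟩ | ⟨rfl, rfl, rfl⟩ <;>
    push_cast at h h1 h2 h3 ⊢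
  · exact con0 _ _ x y u v w hy h (by linarith) (by linarith) (by linarith)
  · exact con1 _ _ x y u v w _ _ _ 6 6 3 hy h h1 h2 h3 (by norm_num) (by norm_num)
      (by norm_num) (by norm_num)
  · exact con2 _ _ x y u v w _ _ _ 6 6 3 hy h h1 h2 h3 (by norm_num) (by norm_num)
      (by norm_num) (by norm_num)
  · exact con3 _ _ x y u v w _ _ _ 3 3 3 hy h h1 h2 h3 (by norm_num) (by norm_num)
      (by norm_num) (by norm_num)

end GG
namespace GG

lemma dvd_aux (d M E a b c f : ℤ) (hM : d ∣ M)
    (h : d ∣ (M + a * E ^ 2) * (M + b * E ^ 2) * (M + c * E ^ 2) * (M + f * E ^ 2)) :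
    d ∣ a * b * c * f * E ^ 8 := by
  have h1 : d ∣ (M + a * E ^ 2) * (M + b * E ^ 2) * (M + c * E ^ 2) * (M + f * E ^ 2) -
      a * b * c * f * E ^ 8 := by
    refine hM.trans ⟨M ^ 3 + M ^ 2 * E ^ 2 * (a + b + c + f) +
      M * E ^ 4 * (a * b + a * c + a * f + b * c + b * f + c * f) +
      E ^ 6 * (a * b * c + a * b * f + a * c * f + b * c * f), by ring⟩
  have := dvd_sub h h1
  rwa [sub_sub_cancel] at this

/-- 2-descent on the genus 2 curve. -/
lemma five (x y : ℚ) (hy : y ≠ 0)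
    (h : y ^ 2 = x * (x - 1) * (x - 2) * (x - 5) * (x - 6)) :
    ∃ d1 d2 d3 d4 d5 : ℤ, (d1, d2, d3, d4, d5) ∈ table5 ∧ ∃ N e u1 u2 u3 u4 u5 : ℤ,
      0 < e ∧ IsCoprime N e ∧ x * (e : ℚ) ^ 2 = N ∧ N = d1 * u1 ^ 2 ∧
      N - 1 * e ^ 2 = d2 * u2 ^ 2 ∧ N - 2 * e ^ 2 = d3 * u3 ^ 2 ∧ N - 5 * e ^ 2 = d4 * u4 ^ 2 ∧
      N - 6 * e ^ 2 = d5 * u5 ^ 2 := by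
  obtain ⟨N, D, hD, hcND, hx⟩ : ∃ N D : ℤ, 0 < D ∧ IsCoprime N D ∧ x * D = N := by
    refine ⟨x.num, x.den, by exact_mod_cast x.den_pos, ?_, by exact_mod_cast rat_eq x⟩
    exact Rat.isCoprime_num_den x
  have cc : ∀ a : ℤ, IsCoprime (N - a * D) D := fun a => by
    rw [sub_eq_add_neg, ← neg_mul]
    exact IsCoprime.add_mul_right_left_iff.mpr hcND
  obtain ⟨⟨e, he, rfl⟩, Y, hY⟩ := den_sq
    (N * (N - 1 * D) * (N - 2 * D) * (N - 5 * D) * (N - 6 * D)) D (y * D ^ 3) hD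
    ((((hcND.mul_left (cc 1)).mul_left (cc 2)).mul_left (cc 5)).mul_left (cc 6)) (by
      push_cast
      rw [← hx, mul_pow, h]; ring)
  have hc : IsCoprime N e := (IsCoprime.pow_right_iff (by norm_num)).mp hcND
  have hce : ∀ a : ℤ, IsCoprime (N - a * e ^ 2) e := fun a => by
    have := cop_shift N e (-a) hc
    rwa [neg_mul, ← sub_eq_add_neg] at this
  have heQ : (e : ℚ) ≠ 0 := by exact_mod_cast he.ne'
  have hY0 : Y ≠ 0 := by
    rintro rfl
    have : ((N * (N - 1 * e ^ 2) * (N - 2 * e ^ 2) * (N - 5 * e ^ 2) * (N - 6 * e ^ 2) : ℤ) : ℚ)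
      = 0 := by rw [hY]; simp
    push_cast at this hx
    rw [← hx] at this
    have h2 : y ^ 2 * (e : ℚ) ^ 10 = 0 := by rw [h, ← this]; ring
    rcases mul_eq_zero.mp h2 with h2 | h2
    · exact hy (by simpa using h2)
    · exact heQ (by simpa using h2)
  have hne : N * (N - 1 * e ^ 2) * (N - 2 * e ^ 2) * (N - 5 * e ^ 2) * (N - 6 * e ^ 2) ≠ 0 := by
    rw [hY]; positivity
  have n1 : N ≠ 0 := fun h0 => hne (by rw [h0]; ring)
  have n2 : N - 1 * e ^ 2 ≠ 0 := fun h0 => hne (by rw [h0]; ring)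
  have n3 : N - 2 * e ^ 2 ≠ 0 := fun h0 => hne (by rw [h0]; ring)
  have n4 : N - 5 * e ^ 2 ≠ 0 := fun h0 => hne (by rw [h0]; ring)
  have n5 : N - 6 * e ^ 2 ≠ 0 := fun h0 => hne (by rw [h0]; ring)
  obtain ⟨d1, u1, e1, v1, s1⟩ := exists_sf N
    ((N + (-1) * e ^ 2) * (N + (-2) * e ^ 2) * (N + (-5) * e ^ 2) * (N + (-6) * e ^ 2)) Y n1
    (by linear_combination hY)
  obtain ⟨d2, u2, e2, v2, s2⟩ := exists_sf (N - 1 * e ^ 2)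
    ((N - 1 * e ^ 2 + 1 * e ^ 2) * (N - 1 * e ^ 2 + (-1) * e ^ 2) *
      (N - 1 * e ^ 2 + (-4) * e ^ 2) * (N - 1 * e ^ 2 + (-5) * e ^ 2)) Y n2
    (by linear_combination hY)
  obtain ⟨d3, u3, e3, v3, s3⟩ := exists_sf (N - 2 * e ^ 2)
    ((N - 2 * e ^ 2 + 2 * e ^ 2) * (N - 2 * e ^ 2 + 1 * e ^ 2) *
      (N - 2 * e ^ 2 + (-3) * e ^ 2) * (N - 2 * e ^ 2 + (-4) * e ^ 2)) Y n3
    (by linear_combination hY)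
  obtain ⟨d4, u4, e4, v4, s4⟩ := exists_sf (N - 5 * e ^ 2)
    ((N - 5 * e ^ 2 + 5 * e ^ 2) * (N - 5 * e ^ 2 + 4 * e ^ 2) *
      (N - 5 * e ^ 2 + 3 * e ^ 2) * (N - 5 * e ^ 2 + (-1) * e ^ 2)) Y n4
    (by linear_combination hY)
  obtain ⟨d5, u5, e5, v5, s5⟩ := exists_sf (N - 6 * e ^ 2)
    ((N - 6 * e ^ 2 + 6 * e ^ 2) * (N - 6 * e ^ 2 + 5 * e ^ 2) *
      (N - 6 * e ^ 2 + 4 * e ^ 2) * (N - 6 * e ^ 2 + 1 * e ^ 2)) Y n5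
    (by linear_combination hY)
  have w1 : d1 ∣ N := ⟨u1 ^ 2, e1⟩
  have w2 : d2 ∣ N - 1 * e ^ 2 := ⟨u2 ^ 2, e2⟩
  have w3 : d3 ∣ N - 2 * e ^ 2 := ⟨u3 ^ 2, e3⟩
  have w4 : d4 ∣ N - 5 * e ^ 2 := ⟨u4 ^ 2, e4⟩
  have w5 : d5 ∣ N - 6 * e ^ 2 := ⟨u5 ^ 2, e5⟩
  have m1 : d1 ∈ cand 60 := mem_cand _ _ (by norm_num) s1 <| by
    simpa using dvd_of_dvd_mul_pow d1 _ N e 8 hc w1 (dvd_aux _ _ _ _ _ _ _ w1 v1)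
  have m2 : d2 ∈ cand 20 := mem_cand _ _ (by norm_num) s2 <| by
    simpa using dvd_of_dvd_mul_pow d2 _ _ e 8 (hce 1) w2 (dvd_aux _ _ _ _ _ _ _ w2 v2)
  have m3 : d3 ∈ cand 24 := mem_cand _ _ (by norm_num) s3 <| by
    simpa using dvd_of_dvd_mul_pow d3 _ _ e 8 (hce 2) w3 (dvd_aux _ _ _ _ _ _ _ w3 v3)
  have m4 : d4 ∈ cand 60 := mem_cand _ _ (by norm_num) s4 <| by
    simpa using dvd_of_dvd_mul_pow d4 _ _ e 8 (hce 5) w4 (dvd_aux _ _ _ _ _ _ _ w4 v4)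
  have m5 : d5 ∈ cand 120 := mem_cand _ _ (by norm_num) s5 <| by
    simpa using dvd_of_dvd_mul_pow d5 _ _ e 8 (hce 6) w5 (dvd_aux _ _ _ _ _ _ _ w5 v5)
  have he2 : 0 < e ^ 2 := by positivity
  have sg1 := sign_step _ _ d2 d1 u2 u1 e2 e1 (by linarith)
  have sg2 := sign_step _ _ d3 d2 u3 u2 e3 e2 (by linarith)
  have sg3 := sign_step _ _ d4 d3 u4 u3 e4 e3 (by linarith)
  have sg4 := sign_step _ _ d5 d4 u5 u4 e5 e4 (by linarith)
  have z1 : u1 ≠ 0 := by rintro rfl; apply n1; rw [e1]; ring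
  have z2 : u2 ≠ 0 := by rintro rfl; apply n2; rw [e2]; ring
  have z3 : u3 ≠ 0 := by rintro rfl; apply n3; rw [e3]; ring
  have z4 : u4 ≠ 0 := by rintro rfl; apply n4; rw [e4]; ring
  have z5 : u5 ≠ 0 := by rintro rfl; apply n5; rw [e5]; ring
  obtain ⟨r, hr⟩ := sq_of_mul_sq (d1 * d2 * d3 * d4 * d5) (u1 * u2 * u3 * u4 * u5) Y
    (by positivity) (by
    rw [← hY, e2, e3, e4, e5]; nth_rewrite 1 [e1]; ring)
  have sq := sqt_sound _ r hr (mul_ne_zero (mul_ne_zero (mul_ne_zero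
    (mul_ne_zero s1.ne_zero s2.ne_zero) s3.ne_zero) s4.ne_zero) s5.ne_zero)
  have g5 : ∀ ad ∈ [((0 : ℤ), d1), (1, d2), (2, d3), (5, d4), (6, d5)],
      ∃ u : ℤ, N - ad.1 * e ^ 2 = ad.2 * u ^ 2 := by
    simp only [List.mem_cons, List.not_mem_nil, or_false, forall_eq_or_imp, forall_eq]
    exact ⟨⟨u1, by linear_combination e1⟩, ⟨u2, e2⟩, ⟨u3, e3⟩, ⟨u4, e4⟩, ⟨u5, e5⟩⟩
  have g2 : ∀ ad ∈ [((0 : ℤ), d1), (1, d2)], ∃ u : ℤ, N - ad.1 * e ^ 2 = ad.2 * u ^ 2 := by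
    intro ad had
    refine g5 ad ?_
    simp only [List.mem_cons, List.not_mem_nil, or_false] at had ⊢
    tauto
  have g3 : ∀ ad ∈ [((0 : ℤ), d1), (1, d2), (2, d3)],
      ∃ u : ℤ, N - ad.1 * e ^ 2 = ad.2 * u ^ 2 := by
    intro ad had
    refine g5 ad ?_
    simp only [List.mem_cons, List.not_mem_nil, or_false] at had ⊢
    tauto
  have g4 : ∀ ad ∈ [((0 : ℤ), d1), (1, d2), (2, d3), (5, d4)],
      ∃ u : ℤ, N - ad.1 * e ^ 2 = ad.2 * u ^ 2 := by
    intro ad had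
    refine g5 ad ?_
    simp only [List.mem_cons, List.not_mem_nil, or_false] at had ⊢
    tauto
  refine ⟨d1, d2, d3, d4, d5, ?_, N, e, u1, u2, u3, u4, u5, he, hc, by exact_mod_cast hx,
    e1, e2, e3, e4, e5⟩
  unfold table5
  rw [List.mem_flatMap]
  refine ⟨d1, m1, ?_⟩
  rw [List.mem_flatMap]
  refine ⟨d2, m2, ?_⟩
  rw [pre_sound N e hc _ g2, sg1]
  simp only [Bool.and_self, if_true]
  rw [List.mem_flatMap]
  refine ⟨d3, m3, ?_⟩
  rw [pre_sound N e hc _ g3, sg2]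
  simp only [Bool.and_self, if_true]
  rw [List.mem_flatMap]
  refine ⟨d4, m4, ?_⟩
  rw [pre_sound N e hc _ g4, sg3]
  simp only [Bool.and_self, if_true]
  rw [List.mem_filterMap]
  refine ⟨d5, m5, ?_⟩
  rw [pre_sound N e hc _ g5, fin_sound N e hc _ g5, sg4, sq]
  simp

/-- the quartic `w² = 2 (v - 1) (v - 2) (v² - 5)` -/
lemma quartic (v w : ℚ) (h : w ^ 2 = 2 * (v - 1) * (v - 2) * (v ^ 2 - 5)) (hw : w ≠ 0) :
    v = 3 ∨ 3 * v = 5 := by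
  have h1 : v - 1 ≠ 0 := by
    intro h0; rw [h0] at h; apply hw; simpa using h
  have h2 : v - 2 ≠ 0 := by
    intro h0; rw [h0] at h; apply hw; simpa using h
  obtain ⟨z, hz⟩ : ∃ z : ℚ, z = (4 - 2 * v) / (v - 1) := ⟨_, rfl⟩
  have hz1 : z * (v - 1) = 4 - 2 * v := by rw [hz]; field_simp
  have hz0 : z ≠ 0 := by
    rintro rfl; apply h2; linarith
  have hY : (w / (v - 1) ^ 2) ^ 2 = z * (z ^ 2 + 3 * z + 1) := by
    rw [div_pow, h, hz]; field_simp; ring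
  obtain ⟨Y, hYd⟩ : ∃ Y, Y = w / (v - 1) ^ 2 := ⟨_, rfl⟩
  rw [← hYd] at hY
  have hY0 : Y ≠ 0 := by rw [hYd]; exact div_ne_zero hw (pow_ne_zero 2 h1)
  have hc := curve45 ((z - 1) ^ 2 / z) (Y * (z ^ 2 - 1) / z ^ 2) (by
    rw [div_pow, mul_pow, hY]; field_simp; ring)
  have h3 : z ^ 2 - 1 = 0 := by
    rcases div_eq_zero_iff.mp hc with h4 | h4
    · rcases mul_eq_zero.mp h4 with h5 | h5
      · exact absurd h5 hY0
      · exact h5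
    · exact absurd h4 (pow_ne_zero 2 hz0)
  have h4 : (z - 1) * (z + 1) = 0 := by linear_combination h3
  rcases mul_eq_zero.mp h4 with h5 | h5
  · right
    have : z = 1 := by linarith
    rw [this] at hz1; linarith
  · left
    have : z = -1 := by linarith
    rw [this] at hz1; linarith

lemma mod5 (p q : ℤ) (h : (5 : ℤ) ∣ p ^ 2 - 2 * q ^ 2) : (5 : ℤ) ∣ q := by
  have h1 : p % 5 = 0 ∨ p % 5 = 1 ∨ p % 5 = 2 ∨ p % 5 = 3 ∨ p % 5 = 4 := by omega
  have h2 : q % 5 = 0 ∨ q % 5 = 1 ∨ q % 5 = 2 ∨ q % 5 = 3 ∨ q % 5 = 4 := by omega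
  have h3 := Int.emod_eq_zero_of_dvd h
  apply Int.dvd_of_emod_eq_zero
  rcases h1 with h1 | h1 | h1 | h1 | h1 <;> rcases h2 with h2 | h2 | h2 | h2 | h2 <;>
    simp [pow_two, Int.sub_emod, Int.mul_emod, h1, h2] at h3 ⊢

lemma delta10 (N e u1 a0 u3 u4 u5 : ℤ) (he : 0 < e) (hc : IsCoprime N e) (e1 : N = 10 * u1 ^ 2)
    (e2' : N - e ^ 2 = a0 ^ 2) (e3 : N - 2 * e ^ 2 = 2 * u3 ^ 2)
    (e4 : N - 5 * e ^ 2 = 5 * u4 ^ 2) (e5 : N - 6 * e ^ 2 = u5 ^ 2) (h5 : u5 ≠ 0) :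
    N = 10 * e ^ 2 := by
  obtain ⟨a, ha, e2⟩ : ∃ a : ℤ, 0 ≤ a ∧ N - e ^ 2 = a ^ 2 :=
    ⟨|a0|, abs_nonneg _, by rw [sq_abs]; exact e2'⟩
  have hN : N = a ^ 2 + e ^ 2 := by linarith
  subst hN
  clear e2 e2'
  have hae : IsCoprime a e := by
    have h1 : a ^ 2 + e ^ 2 = a ^ 2 + e * e := by ring
    rw [h1] at hc
    exact (IsCoprime.pow_left_iff (by norm_num)).mp (IsCoprime.add_mul_right_left_iff.mp hc)
  have hgt : 2 * e < a := by nlinarith [sq_nonneg u5]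
  have hodd : a % 2 = 1 := by
    by_contra hcon
    have ha2 : (2 : ℤ) ∣ a := by omega
    have h2 : (2 : ℤ) ∣ e ^ 2 := by
      obtain ⟨k, rfl⟩ := ha2
      exact ⟨5 * u1 ^ 2 - 2 * k ^ 2, by linarith⟩
    have h3 : (2 : ℤ) ∣ e := Int.prime_two.dvd_of_dvd_pow h2
    have := Int.isUnit_iff.mp (hae.isUnit_of_dvd' ha2 h3)
    omega
  have no5 : (5 : ℤ) ∣ a → (5 : ℤ) ∣ e → False := by
    intro h1 h2
    have := Int.isUnit_iff.mp (hae.isUnit_of_dvd' h1 h2)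
    omega
  have c1 : IsCoprime (a - e) e := by
    have : a - e = a + e * (-1) := by ring
    rw [this]; exact IsCoprime.add_mul_left_left_iff.mpr hae
  have c2 : IsCoprime (a - 2 * e) e := by
    have : a - 2 * e = a + e * (-2) := by ring
    rw [this]; exact IsCoprime.add_mul_left_left_iff.mpr hae
  obtain ⟨d, p, hp, dd, sd⟩ := exists_sf (a - e) (2 * (a + e)) (2 * u3) (by linarith)
    (by linear_combination 2 * e3)
  obtain ⟨f, q, hq, df, sf⟩ := exists_sf (a - 2 * e) (5 * (a + 2 * e)) (5 * u4) (by linarith)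
    (by linear_combination 5 * e4)
  have hd1 : d ∣ a - e := ⟨p ^ 2, hp⟩
  have hf1 : f ∣ a - 2 * e := ⟨q ^ 2, hq⟩
  have hd2 : d ∣ 2 := by
    have h1 : d ∣ 4 * e := by
      have := dvd_sub dd (Dvd.dvd.mul_left hd1 2)
      rwa [show 2 * (a + e) - 2 * (a - e) = 4 * e by ring] at this
    have h2 : d ∣ 2 ^ 2 := (c1.of_isCoprime_of_dvd_left hd1).dvd_of_dvd_mul_right h1
    exact (sd.dvd_pow_iff_dvd (by norm_num)).mp h2
  have hf2 : f ∣ 10 := by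
    have h1 : f ∣ 20 * e := by
      have := dvd_sub df (Dvd.dvd.mul_left hf1 5)
      rwa [show 5 * (a + 2 * e) - 5 * (a - 2 * e) = 20 * e by ring] at this
    have h2 : f ∣ 20 := (c2.of_isCoprime_of_dvd_left hf1).dvd_of_dvd_mul_right h1
    exact (sf.dvd_pow_iff_dvd (by norm_num : (2 : ℕ) ≠ 0)).mp (h2.trans (by norm_num))
  have hdpos : 0 < d := by
    by_contra hcon
    have : d * p ^ 2 ≤ 0 := by nlinarith [sq_nonneg p]
    linarith
  have hfpos : 0 < f := by
    by_contra hcon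
    have : f * q ^ 2 ≤ 0 := by nlinarith [sq_nonneg q]
    linarith
  have hp0 : p ≠ 0 := by rintro rfl; linarith
  have hq0 : q ≠ 0 := by rintro rfl; linarith
  have hd : d = 1 ∨ d = 2 := by
    have := Int.le_of_dvd (by norm_num) hd2
    omega
  have hf : f = 1 ∨ f = 5 := by
    have h1 := Int.le_of_dvd (by norm_num) hf2
    have h2 : ¬ (2 : ℤ) ∣ f := fun h0 => by
      have := h0.trans hf1
      omega
    interval_cases f <;> omega
  have heQ : (e : ℚ) ≠ 0 := by exact_mod_cast he.ne'
  have hu5 : (u5 : ℚ) ≠ 0 := by exact_mod_cast h5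
  have hgtQ : 2 * (e : ℚ) < a := by exact_mod_cast hgt
  have heQp : (0 : ℚ) < e := by exact_mod_cast he
  have f5 : a ^ 2 - 5 * e ^ 2 = u5 ^ 2 := by linarith
  have f5Q : (a : ℚ) ^ 2 - 5 * (e : ℚ) ^ 2 = (u5 : ℚ) ^ 2 := by exact_mod_cast f5
  rcases hd with rfl | rfl <;> rcases hf with rfl | rfl
  · exfalso
    obtain ⟨r, hr⟩ := sq_of_mul_sq (5 * (a + 2 * e)) q (5 * u4) hq0
      (by linear_combination 5 * e4 - 5 * (a + 2 * e) * hq)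
    have h5r : (5 : ℤ) ∣ r := Int.Prime.dvd_pow' (k := 2) (by norm_num) ⟨a + 2 * e, hr.symm⟩
    obtain ⟨s, rfl⟩ := h5r
    have h6 : a + 2 * e = 5 * s ^ 2 := by linarith
    have h7 : (5 : ℤ) ∣ q := mod5 p q ⟨s ^ 2 * (-1) + e, by linarith⟩
    have h8 : (5 : ℤ) ∣ e := by
      obtain ⟨t, rfl⟩ := h7
      have : a - 2 * e = 5 * (5 * t ^ 2) := by linarith
      omega
    exact no5 (by omega) h8
  · exfalso
    obtain ⟨r, hr⟩ := sq_of_mul_sq (2 * (a + e)) p (2 * u3) hp0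
      (by linear_combination 2 * e3 - 2 * (a + e) * hp)
    obtain ⟨s, hs⟩ := sq_of_mul_sq (a + 2 * e) q u4 hq0
      (by
        have : 5 * ((a + 2 * e) * q ^ 2) = 5 * u4 ^ 2 := by
          linear_combination e4 - (a + 2 * e) * hq
        linarith)
    have hpr : 0 ≤ 2 * (a + e) := by linarith
    have hrQ : 2 * ((a : ℚ) + e) = (r : ℚ) ^ 2 := by exact_mod_cast hr
    have hsQ : (a : ℚ) + 2 * e = (s : ℚ) ^ 2 := by exact_mod_cast hs
    have hr0 : (r : ℚ) ≠ 0 := by intro h0; rw [h0] at hrQ; linarith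
    have hs0 : (s : ℚ) ≠ 0 := by intro h0; rw [h0] at hsQ; linarith
    have := quartic (-a / e) (r * s * u5 / e ^ 2) (by
      rw [div_pow, mul_pow, mul_pow, ← hrQ, ← hsQ, ← f5Q]; field_simp; ring)
      (div_ne_zero (mul_ne_zero (mul_ne_zero hr0 hs0) hu5) (pow_ne_zero 2 heQ))
    have hneg : -(a : ℚ) / e < 0 := div_neg_of_neg_of_pos (by linarith) heQp
    rcases this with h | h <;> linarith
  · have hpQ : (a : ℚ) - e = 2 * (p : ℚ) ^ 2 := by exact_mod_cast hp
    have hqQ : (a : ℚ) - 2 * e = (q : ℚ) ^ 2 := by rw [one_mul] at hq; exact_mod_cast hq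
    have hp0' : (p : ℚ) ≠ 0 := by exact_mod_cast hp0
    have hq0' : (q : ℚ) ≠ 0 := by exact_mod_cast hq0
    have := quartic (a / e) (2 * p * q * u5 / e ^ 2) (by
      have h1 : (2 * (p : ℚ) * q * u5) ^ 2 = 2 * (2 * p ^ 2) * q ^ 2 * u5 ^ 2 := by ring
      rw [div_pow, h1, ← hpQ, ← hqQ, ← f5Q]; field_simp)
      (div_ne_zero (mul_ne_zero (mul_ne_zero (mul_ne_zero two_ne_zero hp0') hq0') hu5)
        (pow_ne_zero 2 heQ))
    have h2 : (2 : ℚ) < a / e := by rw [lt_div_iff₀ heQp]; exact hgtQ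
    rcases this with h | h
    · have h3 : (a : ℚ) = 3 * e := by rw [← h]; field_simp
      have h4 : a = 3 * e := by exact_mod_cast h3
      rw [h4]; ring
    · linarith
  · exfalso
    obtain ⟨s, hs⟩ := sq_of_mul_sq (a + 2 * e) q u4 hq0
      (by
        have : 5 * ((a + 2 * e) * q ^ 2) = 5 * u4 ^ 2 := by
          linear_combination e4 - (a + 2 * e) * hq
        linarith)
    have h7 : (5 : ℤ) ∣ s := by
      refine mod5 p s ?_
      exact ⟨-3 * p ^ 2 + 6 * q ^ 2, by linarith⟩
    obtain ⟨t, rfl⟩ := h7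
    have h8 : a + 2 * e = 5 * (5 * t ^ 2) := by linarith
    have h9 : (5 : ℤ) ∣ e := by omega
    exact no5 (by omega) h9

end GG
namespace GG

lemma points (x y : ℚ) (hy : y ≠ 0) (h : y ^ 2 = x * (x - 1) * (x - 2) * (x - 5) * (x - 6)) :
    x = 3 ∨ x = 10 := by
  obtain ⟨d1, d2, d3, d4, d5, hm, N, e, u1, u2, u3, u4, u5, he, hc, hx, e1, e2, e3, e4, e5⟩ :=
    five x y hy h
  have n0 : x ≠ 0 := by rintro rfl; apply hy; simpa using h
  have n1 : x - 1 ≠ 0 := by intro h0; apply hy; rw [h0] at h; simpa using h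
  have n2 : x - 2 ≠ 0 := by intro h0; apply hy; rw [h0] at h; simpa using h
  have n5 : x - 5 ≠ 0 := by intro h0; apply hy; rw [h0] at h; simpa using h
  have n6 : x - 6 ≠ 0 := by intro h0; apply hy; rw [h0] at h; simpa using h
  have heQ : (e : ℚ) ≠ 0 := by exact_mod_cast he.ne'
  obtain ⟨U1, H1⟩ : ∃ U : ℚ, x = d1 * U ^ 2 := ⟨u1 / e, by
    have := congrArg (Int.cast : ℤ → ℚ) e1
    push_cast at this
    field_simp; linear_combination hx + this⟩
  obtain ⟨U2, H2⟩ : ∃ U : ℚ, x - 1 = d2 * U ^ 2 := ⟨u2 / e, by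
    have := congrArg (Int.cast : ℤ → ℚ) e2
    push_cast at this
    field_simp; linear_combination hx + this⟩
  obtain ⟨U3, H3⟩ : ∃ U : ℚ, x - 2 = d3 * U ^ 2 := ⟨u3 / e, by
    have := congrArg (Int.cast : ℤ → ℚ) e3
    push_cast at this
    field_simp; linear_combination hx + this⟩
  obtain ⟨U4, H4⟩ : ∃ U : ℚ, x - 5 = d4 * U ^ 2 := ⟨u4 / e, by
    have := congrArg (Int.cast : ℤ → ℚ) e4
    push_cast at this
    field_simp; linear_combination hx + this⟩
  obtain ⟨U5, H5⟩ : ∃ U : ℚ, x - 6 = d5 * U ^ 2 := ⟨u5 / e, by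
    have := congrArg (Int.cast : ℤ → ℚ) e5
    push_cast at this
    field_simp; linear_combination hx + this⟩
  have z1 : U1 ≠ 0 := by rintro rfl; apply n0; rw [H1]; ring
  have z2 : U2 ≠ 0 := by rintro rfl; apply n1; rw [H2]; ring
  have z3 : U3 ≠ 0 := by rintro rfl; apply n2; rw [H3]; ring
  have z4 : U4 ≠ 0 := by rintro rfl; apply n5; rw [H4]; ring
  have z5 : U5 ≠ 0 := by rintro rfl; apply n6; rw [H5]; ring
  -- the classes for which `x - 2` is a square
  have sq3 : ∀ c : ℚ, c ≠ 0 → (c * U1 * U2 * U4 * U5) ^ 2 = x * (x - 1) * (x - 5) * (x - 6) →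
      x = 3 := by
    intro c hc0 h0
    have := curve59 ((x - 3) ^ 2 - 9) ((x - 3) * (c * U1 * U2 * U4 * U5)) (by
      rw [mul_pow, h0]; ring)
    rcases mul_eq_zero.mp this with h1 | h1
    · linarith
    · exfalso; revert h1; positivity
  rw [t5] at hm
  simp only [List.mem_cons, Prod.mk.injEq, List.not_mem_nil, or_false] at hm
  rcases hm with ⟨rfl, rfl, rfl, rfl, rfl⟩ | ⟨rfl, rfl, rfl, rfl, rfl⟩ | ⟨rfl, rfl, rfl, rfl, rfl⟩ |
    ⟨rfl, rfl, rfl, rfl, rfl⟩ | ⟨rfl, rfl, rfl, rfl, rfl⟩ | ⟨rfl, rfl, rfl, rfl, rfl⟩ |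
    ⟨rfl, rfl, rfl, rfl, rfl⟩ | ⟨rfl, rfl, rfl, rfl, rfl⟩ <;> push_cast at H1 H2 H3 H4 H5
  · exfalso
    have := curve45 (x - 5) (U1 * U2 * U4) (by
      have : (x - 5) * (x - 5 + 4) * (x - 5 + 5) = x * (x - 1) * (x - 5) := by ring
      rw [this, H2, H4]; nth_rewrite 1 [H1]; ring)
    revert this; positivity
  · exfalso
    have := curve45 (1 - x) (5 * U2 * U4 * U5) (by
      have : (1 - x) * (1 - x + 4) * (1 - x + 5) = -((x - 1) * (x - 5) * (x - 6)) := by ring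
      rw [this, H2, H4, H5]; ring)
    revert this; positivity
  · exfalso
    have := curve25 (-x) (6 * U1 * U3 * U4) (by
      have : -x * (-x + 2) * (-x + 5) = -(x * (x - 2) * (x - 5)) := by ring
      rw [this, H3, H4]; nth_rewrite 1 [H1]; ring)
    revert this; positivity
  · left
    refine sq3 6 (by norm_num) ?_
    rw [H2, H4, H5]; nth_rewrite 1 [H1]; ring
  · exfalso
    have := curve25 (-x) (15 * U1 * U3 * U4) (by
      have : -x * (-x + 2) * (-x + 5) = -(x * (x - 2) * (x - 5)) := by ring
      rw [this, H3, H4]; nth_rewrite 1 [H1]; ring)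
    revert this; positivity
  · left
    refine sq3 30 (by norm_num) ?_
    rw [H2, H4, H5]; nth_rewrite 1 [H1]; ring
  · right
    have h5 : u5 ≠ 0 := by
      rintro rfl
      have := congrArg (Int.cast : ℤ → ℚ) e5
      push_cast at this
      rw [← hx] at this
      have h7 : (x - 6) * (e : ℚ) ^ 2 = 0 := by linear_combination this
      rcases mul_eq_zero.mp h7 with h8 | h8
      · exact n6 h8
      · exact pow_ne_zero 2 heQ h8
    have h10 := delta10 N e u1 u2 u3 u4 u5 he hc e1 (by linarith) e3 e4 (by linarith) h5
    rw [h10] at hx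
    push_cast at hx
    exact mul_right_cancel₀ (pow_ne_zero 2 heQ) hx
  · exfalso
    have := curve1215 (3 * x - 15) (45 * U1 * U2 * U4) (by
      have : (3 * x - 15) * (3 * x - 15 + 12) * (3 * x - 15 + 15) =
        27 * (x * (x - 1) * (x - 5)) := by ring
      rw [this, H2, H4]; nth_rewrite 1 [H1]; ring)
    revert this; positivity

end GG

/-- The rational points on the affine curve `y² = x(x-1)(x-2)(x-5)(x-6)`
(the Gordon–Grant genus-2 curve) are exactly the nine listed points. -/
theorem gordon_grant_rational_points :
    {P : ℚ × ℚ | P.2 ^ 2 = P.1 * (P.1 - 1) * (P.1 - 2) * (P.1 - 5) * (P.1 - 6)} =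
      ({(0, 0), (1, 0), (2, 0), (5, 0), (6, 0), (3, 6), (3, -6), (10, 120), (10, -120)} :
        Set (ℚ × ℚ)) := by
  ext ⟨x, y⟩
  simp only [Set.mem_ofPred_eq, Set.mem_insert_iff, Set.mem_singleton_iff, Prod.mk.injEq]
  constructor
  · intro h
    by_cases hy : y = 0
    · subst hy
      have h0 : x * (x - 1) * (x - 2) * (x - 5) * (x - 6) = 0 := by rw [← h]; ring
      simp only [mul_eq_zero, sub_eq_zero] at h0
      tauto
    · rcases GG.points x y hy h with rfl | rfl
      · have h1 : (y - 6) * (y + 6) = 0 := by linear_combination h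
        rcases mul_eq_zero.mp h1 with h2 | h2
        · have : y = 6 := by linarith
          subst this; norm_num
        · have : y = -6 := by linarith
          subst this; norm_num
      · have h1 : (y - 120) * (y + 120) = 0 := by linear_combination h
        rcases mul_eq_zero.mp h1 with h2 | h2
        · have : y = 120 := by linarith
          subst this; norm_num
        · have : y = -120 := by linarith
          subst this; norm_num
  · rintro (⟨rfl, rfl⟩ | ⟨rfl, rfl⟩ | ⟨rfl, rfl⟩ | ⟨rfl, rfl⟩ | ⟨rfl, rfl⟩ | ⟨rfl, rfl⟩ |
      ⟨rfl, rfl⟩ | ⟨rfl, rfl⟩ | ⟨rfl, rfl⟩) <;> norm_num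
end

section
/- Let p be a prime and let a : ℕ → ℚ_p be a sequence with ‖a n‖ → 0 as n → ∞, such that a n ≠ 0 for some n. Then the set {x ∈ ℤ_p : ∑' n, a n · xⁿ = 0} is finite. -/
open Filter

/-- Norms of a null sequence attain their maximum. -/
theorem strassmann_exists_max (c : ℕ → ℝ) (h0 : ∀ n, 0 ≤ c n)
    (hc : Tendsto c atTop (nhds 0)) : ∃ m, ∀ n, c n ≤ c m := by
  by_cases h : ∃ k, c k ≠ 0
  · obtain ⟨k, hk⟩ := h
    have hk' : 0 < c k := lt_of_le_of_ne (h0 k) (Ne.symm hk)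
    have hev : ∀ᶠ n in atTop, c n < c k := hc.eventually_lt_const hk'
    refine Continuous.exists_forall_ge' (f := c) continuous_of_discreteTopology k ?_
    rw [Filter.cocompact_eq_cofinite, Nat.cofinite_eq_atTop]
    exact hev.mono fun n hn => hn.le
  · push Not at h
    exact ⟨0, fun n => by simp [h]⟩

theorem strassmann_term_norm_le (p : ℕ) [Fact p.Prime] (c : ℚ_[p]) (x : ℤ_[p]) (n : ℕ) :
    ‖c * (x : ℚ_[p]) ^ n‖ ≤ ‖c‖ := by
  rw [norm_mul, norm_pow]
  have hx : ‖(x : ℚ_[p])‖ ≤ 1 := x.2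
  exact mul_le_of_le_one_right (norm_nonneg _) (pow_le_one₀ (norm_nonneg _) hx)

theorem strassmann_summable (p : ℕ) [Fact p.Prime] (a : ℕ → ℚ_[p])
    (ha : Tendsto (fun n => ‖a n‖) atTop (nhds 0)) (x : ℤ_[p]) :
    Summable fun n => a n * (x : ℚ_[p]) ^ n := by
  apply NonarchimedeanAddGroup.summable_of_tendsto_cofinite_zero
  rw [Nat.cofinite_eq_atTop]
  exact squeeze_zero_norm (fun n => strassmann_term_norm_le p (a n) x n) ha

theorem strassmann_aux (p : ℕ) [Fact p.Prime] (C D : ℝ) (hD : 0 ≤ D) (hDC : D < C) (N : ℕ) :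
    ∀ a : ℕ → ℚ_[p], Tendsto (fun n => ‖a n‖) atTop (nhds 0) → (∀ n, ‖a n‖ ≤ C) →
      ‖a N‖ = C → (∀ n, N < n → ‖a n‖ ≤ D) →
      {x : ℤ_[p] | ∑' n : ℕ, a n * (x : ℚ_[p]) ^ n = 0}.Finite := by
  induction N with
  | zero =>
    intro a ha _ hN ht
    convert Set.finite_empty
    ext x
    simp only [Set.mem_setOf_eq, Set.mem_empty_iff_false, iff_false]
    intro hx
    rw [(strassmann_summable p a ha x).tsum_eq_zero_add] at hx
    have h1 : ‖∑' n : ℕ, a (n + 1) * (x : ℚ_[p]) ^ (n + 1)‖ ≤ D :=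
      IsUltrametricDist.norm_tsum_le_of_forall_le fun n =>
        (strassmann_term_norm_le p _ x _).trans (ht _ (Nat.succ_pos n))
    rw [pow_zero, mul_one] at hx
    rw [← neg_eq_of_add_eq_zero_right hx, norm_neg, hN] at h1
    linarith
  | succ N ih =>
    intro a ha hC hN ht
    by_cases hr : ∃ y : ℤ_[p], ∑' n : ℕ, a n * (y : ℚ_[p]) ^ n = 0
    swap
    · push Not at hr
      convert Set.finite_empty
      ext x
      simpa using hr x
    obtain ⟨y, hy⟩ := hr
    set b : ℕ → ℚ_[p] := fun j => ∑' k : ℕ, a (k + (j + 1)) * (y : ℚ_[p]) ^ k with hb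
    have hshift : ∀ j, Tendsto (fun n => ‖a (n + j)‖) atTop (nhds 0) := fun j =>
      ha.comp (tendsto_add_atTop_nat j)
    have hyn : ‖(y : ℚ_[p])‖ ≤ 1 := y.2
    have hbound : ∀ (j : ℕ) (E : ℝ), (∀ n, j < n → ‖a n‖ ≤ E) → ‖b j‖ ≤ E := by
      intro j E h
      exact IsUltrametricDist.norm_tsum_le_of_forall_le fun k =>
        (strassmann_term_norm_le p _ y _).trans (h _ (by lia))
    have hrec0 : ∀ (c : ℕ → ℚ_[p]), Tendsto (fun n => ‖c n‖) atTop (nhds 0) →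
        ∑' k : ℕ, c k * (y : ℚ_[p]) ^ k
          = c 0 + y * ∑' k : ℕ, c (k + 1) * (y : ℚ_[p]) ^ k := by
      intro c hc
      rw [(strassmann_summable p c hc y).tsum_eq_zero_add, ← tsum_mul_left]
      simp only [pow_zero, mul_one]
      congr 1
      exact tsum_congr fun k => by ring
    have hrec : ∀ j, b j = a (j + 1) + y * b (j + 1) := by
      intro j
      have := hrec0 (fun k => a (k + (j + 1))) (hshift _)
      simp only [hb]
      rw [this]
      simp only [zero_add]
      congr 2
      exact tsum_congr fun k => by rw [show k + 1 + (j + 1) = k + (j + 1 + 1) by ring]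
    have hb0 : a 0 + y * b 0 = 0 := by
      rw [← hy, hrec0 a ha]
    have hbt : Tendsto (fun n => ‖b n‖) atTop (nhds 0) := by
      rw [Metric.tendsto_atTop] at ha ⊢
      intro ε hε
      obtain ⟨M, hM⟩ := ha (ε / 2) (half_pos hε)
      refine ⟨M, fun n hn => ?_⟩
      have := hbound n (ε / 2) fun m hm => by
        have := hM m (by lia)
        simp only [dist_zero_right, norm_norm] at this
        exact this.le
      simp only [dist_zero_right, norm_norm]
      linarith
    have hbN : ‖b N‖ = C := by
      have h1 : ‖(y : ℚ_[p]) * b (N + 1)‖ ≤ D := by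
        rw [norm_mul]
        exact (mul_le_of_le_one_left (norm_nonneg _) hyn).trans (hbound _ _ ht)
      rw [hrec, IsUltrametricDist.norm_add_eq_max_of_norm_ne_norm, hN, max_eq_left]
      · linarith
      · rw [hN]
        intro h
        linarith
    have hfin := ih b hbt (fun n => hbound n C fun m _ => hC m) hbN
      (fun n hn => hbound n D fun m hm => ht m (by lia))
    refine (hfin.insert y).subset ?_
    intro x hx
    simp only [Set.mem_setOf_eq] at hx
    rw [Set.mem_insert_iff, or_iff_not_imp_left]
    intro hxy
    simp only [Set.mem_setOf_eq]
    have hsb := strassmann_summable p b hbt x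
    have key : ((x : ℚ_[p]) - y) * ∑' n : ℕ, b n * (x : ℚ_[p]) ^ n = 0 := by
      have e1 : ∑' n : ℕ, a (n + 1) * (x : ℚ_[p]) ^ (n + 1)
          = x * (∑' n : ℕ, b n * (x : ℚ_[p]) ^ n)
            - y * ∑' n : ℕ, b (n + 1) * (x : ℚ_[p]) ^ (n + 1) := by
        have hs1 : Summable fun n : ℕ => b (n + 1) * (x : ℚ_[p]) ^ (n + 1) :=
          (summable_nat_add_iff 1).2 hsb
        rw [← tsum_mul_left, ← tsum_mul_left,
          ← (hsb.mul_left (x : ℚ_[p])).tsum_sub (hs1.mul_left (y : ℚ_[p]))]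
        refine tsum_congr fun n => ?_
        rw [hrec n]
        ring
      have e2 := (strassmann_summable p a ha x).tsum_eq_zero_add
      have e3 := hsb.tsum_eq_zero_add
      rw [hx] at e2
      simp only [pow_zero, mul_one] at e2 e3
      linear_combination (-1 : ℚ_[p]) * e2 - e1 - y * e3 - hb0
    rcases mul_eq_zero.1 key with h | h
    · exact absurd (Subtype.ext (sub_eq_zero.1 h)) hxy
    · exact h

/-- Strassmann-type finiteness: a nonzero `p`-adic power series converging on `ℤ_p`
has only finitely many zeros in `ℤ_p`. -/
theorem strassmann_finiteness (p : ℕ) [Fact p.Prime] (a : ℕ → ℚ_[p])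
    (ha : Tendsto (fun n => ‖a n‖) atTop (nhds 0)) (hne : ∃ n, a n ≠ 0) :
    {x : ℤ_[p] | ∑' n : ℕ, a n * (x : ℚ_[p]) ^ n = 0}.Finite := by
  obtain ⟨m, hm⟩ := strassmann_exists_max _ (fun n => norm_nonneg (a n)) ha
  obtain ⟨k, hk⟩ := hne
  have hpos : 0 < ‖a m‖ := (norm_pos_iff.2 hk).trans_le (hm k)
  obtain ⟨M, hM⟩ := eventually_atTop.1 (ha.eventually_lt_const hpos)
  classical
  set N := Nat.findGreatest (fun n => ‖a n‖ = ‖a m‖) M with hNdef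
  have hmM : m ≤ M := by
    by_contra h
    exact lt_irrefl _ (hM m (by lia))
  have hN : ‖a N‖ = ‖a m‖ :=
    Nat.findGreatest_spec (P := fun n => ‖a n‖ = ‖a m‖) hmM rfl
  have hgt : ∀ n, N < n → ‖a n‖ < ‖a m‖ := by
    intro n hn
    by_cases h : n ≤ M
    · exact lt_of_le_of_ne (hm n) (Nat.findGreatest_is_greatest hn h)
    · exact hM n (by lia)
  obtain ⟨q, hq⟩ := strassmann_exists_max (fun n => ‖a (n + (N + 1))‖)
    (fun n => norm_nonneg _) (ha.comp (tendsto_add_atTop_nat (N + 1)))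
  refine strassmann_aux p ‖a m‖ ‖a (q + (N + 1))‖ (norm_nonneg _) (hgt _ (by lia)) N a ha hm hN ?_
  intro n hn
  have := hq (n - (N + 1))
  rwa [Nat.sub_add_cancel (by lia)] at this
end

section
/- Let p be a prime and let a : ℕ → ℤ_p be a sequence. Suppose n₀ ∈ ℕ satisfies ‖a n₀‖ = 1 and ‖a n‖ < 1 for all n < n₀. Then the set {x ∈ ℚ_p : ‖x‖ < 1 and ∑' n, a n · xⁿ = 0} has cardinality at most n₀. -/
/-- Closed balls of `ℤ_p` are ideals. -/
def padicBallIdeal (p : ℕ) [Fact p.Prime] (ε : ℝ) : Ideal ℤ_[p] where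
  carrier := {x | ‖x‖ ≤ |ε|}
  add_mem' := fun {x y} hx hy => (PadicInt.nonarchimedean x y).trans (max_le hx hy)
  zero_mem' := by simp
  smul_mem' := fun c x hx => by
    have hc := PadicInt.norm_le_one c
    have hx' : ‖x‖ ≤ |ε| := hx
    change ‖c * x‖ ≤ |ε|
    rw [norm_mul]
    nlinarith [norm_nonneg x, norm_nonneg c]

theorem padicInt_isLinearTopology (p : ℕ) [Fact p.Prime] : IsLinearTopology ℤ_[p] ℤ_[p] := by
  refine IsLinearTopology.mk_of_hasBasis (ι := ℝ) (p := fun ε => 0 < ε) ℤ_[p]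
    (S := Ideal ℤ_[p]) (s := padicBallIdeal p) ?_
  refine (Metric.nhds_basis_closedBall (x := (0 : ℤ_[p]))).congr (fun _ => Iff.rfl) ?_
  intro ε hε
  ext x
  change dist x 0 ≤ ε ↔ ‖x‖ ≤ |ε|
  rw [dist_zero_right, abs_of_pos hε]

/-- Local zero-count bound: a power series over `ℤ_p` whose reduction mod `p`
vanishes to exact order `n₀` has at most `n₀` zeros in the open unit disc of `ℚ_p`. -/
theorem local_zero_bound (p : ℕ) [Fact p.Prime] (a : ℕ → ℤ_[p]) (n₀ : ℕ)
    (h₀ : ‖a n₀‖ = 1) (hlt : ∀ n : ℕ, n < n₀ → ‖a n‖ < 1) :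
    {x : ℚ_[p] | ‖x‖ < 1 ∧ ∑' n : ℕ, (a n : ℚ_[p]) * x ^ n = 0}.encard ≤ n₀ := by
  classical
  have := padicInt_isLinearTopology p
  set g : PowerSeries ℤ_[p] := PowerSeries.mk a with hg
  have hc0 : PowerSeries.coeff n₀ (g.map (IsLocalRing.residue ℤ_[p])) ≠ 0 := by
    rw [PowerSeries.coeff_map, hg, PowerSeries.coeff_mk, IsLocalRing.residue_ne_zero_iff_isUnit]
    exact PadicInt.isUnit_iff.2 h₀
  have hne : g.map (IsLocalRing.residue ℤ_[p]) ≠ 0 := by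
    intro h
    rw [h] at hc0
    simp at hc0
  have hord : (g.map (IsLocalRing.residue ℤ_[p])).order = n₀ := by
    rw [PowerSeries.order_eq_nat]
    refine ⟨hc0, fun i hi => ?_⟩
    rw [PowerSeries.coeff_map, hg, PowerSeries.coeff_mk, IsLocalRing.residue_eq_zero_iff,
      IsLocalRing.mem_maximalIdeal]
    exact PadicInt.mem_nonunits.2 (hlt i hi)
  obtain ⟨f, h, H⟩ := PowerSeries.exists_isWeierstrassFactorization hne
  have hdeg : f.natDegree = n₀ := by
    rw [H.natDegree_eq_toNat_order_map, hord, ENat.toNat_natCast]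
  have hf0 : f ≠ 0 := H.isDistinguishedAt.monic.ne_zero
  have hsub : {x : ℚ_[p] | ‖x‖ < 1 ∧ ∑' n : ℕ, (a n : ℚ_[p]) * x ^ n = 0} ⊆
      ((f.roots.toFinset.image (fun y : ℤ_[p] => (y : ℚ_[p])) : Finset ℚ_[p]) : Set ℚ_[p]) := by
    rintro x ⟨hx1, hx0⟩
    obtain ⟨y, rfl⟩ : ∃ y : ℤ_[p], (y : ℚ_[p]) = x := ⟨⟨x, hx1.le⟩, rfl⟩
    have hy : PowerSeries.HasEval y := tendsto_pow_atTop_nhds_zero_of_norm_lt_one hx1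
    have hs := PowerSeries.hasSum_aeval hy g
    have hs2 := hs.map PadicInt.Coe.ringHom continuous_subtype_val
    have hs3 : HasSum (fun n => (a n : ℚ_[p]) * (y : ℚ_[p]) ^ n)
        ((PowerSeries.aeval hy g : ℤ_[p]) : ℚ_[p]) := by
      convert hs2 using 1
      · funext n
        simp only [Function.comp_apply, hg, PowerSeries.coeff_mk, smul_eq_mul, map_mul, map_pow]
        rfl
      · rfl
    have hz : PowerSeries.aeval hy g = 0 := by
      have := hs3.tsum_eq
      rw [hx0] at this
      exact Subtype.ext this.symm
    rw [H.eq_mul, map_mul, PowerSeries.aeval_coe] at hz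
    have hu : IsUnit (PowerSeries.aeval hy h) := H.isUnit.map _
    have hr : f.IsRoot y := by
      rcases mul_eq_zero.1 hz with h1 | h1
      · simpa [Polynomial.IsRoot] using h1
      · exact absurd h1 hu.ne_zero
    simp only [Finset.coe_image, Set.mem_image]
    exact ⟨y, by simpa [hf0] using hr, rfl⟩
  refine (Set.encard_le_encard hsub).trans ?_
  rw [Set.encard_coe_eq_coe_finsetCard]
  have : (f.roots.toFinset.image (fun y : ℤ_[p] => (y : ℚ_[p]))).card ≤ n₀ :=
    Finset.card_image_le.trans ((Multiset.toFinset_card_le _).trans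
      ((Polynomial.card_roots' f).trans hdeg.le))
  exact_mod_cast this
end

section
/- Let p be a prime and let a : ℕ → ℤ_p be a sequence. Suppose n₀ ∈ ℕ satisfies ‖a n₀‖ = 1 and ‖a n‖ < 1 for all n < n₀, and suppose p > n₀ + 2. Then the set {x ∈ ℚ_p : ‖x‖ ≤ 1/p and ∑' n, (a n / (n+1)) · x^(n+1) = 0} has cardinality at most n₀ + 1. -/
open Filter Topology in
lemma summable_aux {p : ℕ} [Fact p.Prime] {c : ℕ → ℚ_[p]} (hc : Tendsto c atTop (𝓝 0))
    {x : ℚ_[p]} (hx : ‖x‖ ≤ 1) : Summable (fun n => c n * x ^ n) := by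
  apply NonarchimedeanAddGroup.summable_of_tendsto_cofinite_zero
  rw [Nat.cofinite_eq_atTop]
  apply squeeze_zero_norm (a := fun n => ‖c n‖)
  · intro n
    rw [norm_mul, norm_pow]
    exact mul_le_of_le_one_right (norm_nonneg _) (pow_le_one₀ (norm_nonneg _) hx)
  · simpa using hc.norm

lemma term_le_aux {p : ℕ} [Fact p.Prime] {c x : ℚ_[p]} {ε : ℝ} (hc : ‖c‖ ≤ ε)
    (hx : ‖x‖ ≤ 1) (n : ℕ) : ‖c * x ^ n‖ ≤ ε := by
  rw [norm_mul, norm_pow]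
  exact (mul_le_of_le_one_right (norm_nonneg _) (pow_le_one₀ (norm_nonneg _) hx)).trans hc

open Filter Topology in
/-- Strassman's theorem over `ℚ_p`. -/
lemma strassman {p : ℕ} [Fact p.Prime] (N : ℕ) : ∀ (c : ℕ → ℚ_[p]) (_ : Tendsto c atTop (𝓝 0))
    (ε : ℝ) (_ : ε < ‖c N‖) (_ : ∀ m, N < m → ‖c m‖ ≤ ε),
    {x : ℚ_[p] | ‖x‖ ≤ 1 ∧ ∑' n : ℕ, c n * x ^ n = 0}.encard ≤ N := by
  induction N with
  | zero =>
    intro c hc ε hε hm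
    have : {x : ℚ_[p] | ‖x‖ ≤ 1 ∧ ∑' n : ℕ, c n * x ^ n = 0} = ∅ := by
      ext x
      simp only [Set.mem_setOf_eq, Set.mem_empty_iff_false, iff_false, not_and]
      intro hx h0
      rw [(summable_aux hc hx).tsum_eq_zero_add] at h0
      have h1 : ‖∑' n : ℕ, c (n + 1) * x ^ (n + 1)‖ ≤ ε :=
        IsUltrametricDist.norm_tsum_le_of_forall_le
          (fun n => term_le_aux (hm _ (Nat.succ_pos n)) hx _)
      have h2 : c 0 = - ∑' n : ℕ, c (n + 1) * x ^ (n + 1) := by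
        simpa using eq_neg_of_add_eq_zero_left h0
      rw [h2, norm_neg] at hε
      linarith
    rw [this]; simp
  | succ N ih =>
    intro c hc ε hε hm
    rcases Set.eq_empty_or_nonempty {x : ℚ_[p] | ‖x‖ ≤ 1 ∧ ∑' n : ℕ, c n * x ^ n = 0}
      with h | ⟨α, hα, hα0⟩
    · rw [h]; simp
    let b : ℕ → ℚ_[p] := fun j => ∑' k : ℕ, c (j + 1 + k) * α ^ k
    have hshift : ∀ j, Tendsto (fun k => c (j + k)) atTop (𝓝 0) := fun j =>
      hc.comp (tendsto_add_atTop_nat j |>.congr fun k => add_comm _ _)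
    have hb : ∀ j, b j = c (j + 1) + α * b (j + 1) := by
      intro j
      simp only [b]
      rw [(summable_aux (hshift (j + 1)) hα).tsum_eq_zero_add, ← tsum_mul_left]
      simp only [add_zero, pow_zero, mul_one]
      congr 1
      refine tsum_congr fun k => ?_
      rw [show j + 1 + (k + 1) = j + 1 + 1 + k by ring]; ring
    have hb0 : c 0 + α * b 0 = 0 := by
      rw [← hα0, (summable_aux hc hα).tsum_eq_zero_add]
      simp only [b]
      rw [← tsum_mul_left]
      simp only [pow_zero, mul_one]
      congr 1
      refine tsum_congr fun k => ?_
      rw [show 0 + 1 + k = k + 1 by ring]; ring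
    have hbε : ∀ δ j, (∀ m, j < m → ‖c m‖ ≤ δ) → ‖b j‖ ≤ δ := fun δ j h =>
      IsUltrametricDist.norm_tsum_le_of_forall_le
        (fun n => term_le_aux (h _ (by omega)) hα _)
    have hbt : Tendsto b atTop (𝓝 0) := by
      rw [Metric.tendsto_atTop] at hc ⊢
      intro δ hδ
      obtain ⟨M, hM⟩ := hc (δ / 2) (by positivity)
      refine ⟨M, fun n hn => ?_⟩
      have := hbε (δ / 2) n (fun m hm => by simpa using (hM m (by omega)).le)
      rw [dist_zero_right]; linarith
    have hbN : ‖b N‖ = ‖c (N + 1)‖ := by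
      have h1 : ‖α * b (N + 1)‖ < ‖c (N + 1)‖ := by
        have h2 := hbε ε (N + 1) hm
        rw [norm_mul]
        exact (mul_le_of_le_one_left (norm_nonneg _) hα).trans_lt (h2.trans_lt hε)
      rw [hb N, IsUltrametricDist.norm_add_eq_max_of_norm_ne_norm h1.ne', max_eq_left h1.le]
    have key := ih b hbt ε (by rw [hbN]; exact hε)
      (fun m hNm => hbε ε m fun k hk => hm k (by omega))
    have hsub : {x : ℚ_[p] | ‖x‖ ≤ 1 ∧ ∑' n : ℕ, c n * x ^ n = 0} ⊆
        insert α {x : ℚ_[p] | ‖x‖ ≤ 1 ∧ ∑' n : ℕ, b n * x ^ n = 0} := by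
      rintro x ⟨hx, hx0⟩
      by_cases hxa : x = α
      · exact Or.inl hxa
      refine Or.inr ⟨hx, ?_⟩
      have sb := summable_aux hbt hx
      have sb1 : Summable (fun n => b (n + 1) * x ^ (n + 1)) :=
        (summable_nat_add_iff (f := fun n => b n * x ^ n) 1).2 sb
      have e1 := sb.tsum_eq_zero_add
      have e2 : ∑' n, c (n + 1) * x ^ (n + 1) =
          x * ∑' n, b n * x ^ n - α * ∑' n, b (n + 1) * x ^ (n + 1) := by
        rw [← tsum_mul_left, ← tsum_mul_left, ← (sb.mul_left x).tsum_sub (sb1.mul_left α)]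
        refine tsum_congr fun n => ?_
        rw [hb n]; ring
      rw [(summable_aux hc hx).tsum_eq_zero_add, e2] at hx0
      have : (x - α) * ∑' n, b n * x ^ n = 0 := by
        simp only [pow_zero, mul_one] at hx0 e1
        linear_combination hx0 - hb0 - α * e1
      exact (mul_eq_zero.1 this).resolve_left (sub_ne_zero.2 hxa)
    calc _ ≤ _ := Set.encard_le_encard hsub
      _ ≤ _ := Set.encard_insert_le _ _
      _ ≤ ((N + 1 : ℕ) : ℕ∞) := by push_cast; gcongr

lemma norm_coeff_aux {p : ℕ} [hp : Fact p.Prime] (m : ℕ) (hm : m ≠ 0) : ∃ e : ℕ, p ^ e ≤ m ∧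
    ‖(p : ℚ_[p]) ^ m / (m : ℚ_[p])‖ = (p : ℝ) ^ e * (1 / p : ℝ) ^ m := by
  obtain ⟨e, k, hk, rfl⟩ := Nat.exists_eq_pow_mul_and_not_dvd hm p hp.out.ne_one
  refine ⟨e, Nat.le_mul_of_pos_right _ (Nat.pos_of_ne_zero (by rintro rfl; simp at hk)), ?_⟩
  have h1 : ‖(k : ℚ_[p])‖ = 1 :=
    Padic.norm_natCast_eq_one_iff.2 ((Nat.Prime.coprime_iff_not_dvd hp.out).2 hk)
  rw [norm_div, norm_pow, Nat.cast_mul, norm_mul, h1, Nat.cast_pow, norm_pow, Padic.norm_p]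
  simp [div_eq_mul_inv, mul_comm]

lemma exp_aux {p e m n : ℕ} (hp : p > n + 2) (h : p ^ e ≤ m) (hm : n + 1 < m) :
    e + (n + 2) ≤ m := by
  rcases e with _ | e
  · omega
  have h1 : e + 1 ≤ p ^ e := Nat.lt_pow_self (by omega)
  have h2 : p ^ (e + 1) = p * p ^ e := by ring
  have h3 : p * (e + 1) ≤ p * p ^ e := Nat.mul_le_mul_left _ h1
  have h4 : p + e ≤ p * (e + 1) := by nlinarith
  omega


/-- The `p`-adic Rolle bound of Coleman's explicit Chabauty: the term-by-term
antiderivative `∑ (a n/(n+1)) x^(n+1)` of a power series over `ℤ_p` whose reduction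
mod `p` vanishes to exact order `n₀` has at most `n₀ + 1` zeros in the disc of
radius `1/p`, provided `p > n₀ + 2`. -/
theorem padic_rolle_bound (p : ℕ) [Fact p.Prime] (a : ℕ → ℤ_[p]) (n₀ : ℕ)
    (h₀ : ‖a n₀‖ = 1) (hlt : ∀ n : ℕ, n < n₀ → ‖a n‖ < 1) (hp : p > n₀ + 2) :
    {x : ℚ_[p] | ‖x‖ ≤ 1 / p ∧
        ∑' n : ℕ, ((a n : ℚ_[p]) / ((n : ℚ_[p]) + 1)) * x ^ (n + 1) = 0}.encard
      ≤ n₀ + 1 := by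
  have hpp : p.Prime := Fact.out
  have hp0 : (0 : ℝ) < p := by exact_mod_cast hpp.pos
  have hp1 : (1 : ℝ) < p := by exact_mod_cast hpp.one_lt
  have hpQ : (p : ℚ_[p]) ≠ 0 := by exact_mod_cast hpp.ne_zero
  have hr0 : (0 : ℝ) < 1 / p := by positivity
  have hr1 : (1 / p : ℝ) < 1 := by rw [div_lt_one hp0]; exact hp1
  let c : ℕ → ℚ_[p] := fun m => (a (m - 1) : ℚ_[p]) * ((p : ℚ_[p]) ^ m / (m : ℚ_[p]))
  have hcle : ∀ m, ‖c m‖ ≤ ‖(p : ℚ_[p]) ^ m / (m : ℚ_[p])‖ := fun m => by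
    simp only [c]
    rw [norm_mul]
    exact mul_le_of_le_one_left (norm_nonneg _) (PadicInt.norm_le_one _)
  have hct : Filter.Tendsto c Filter.atTop (nhds 0) := by
    refine squeeze_zero_norm (fun m => ?_) (tendsto_self_mul_const_pow_of_lt_one hr0.le hr1)
    rcases eq_or_ne m 0 with rfl | hm
    · simp [c]
    obtain ⟨e, he, h⟩ := norm_coeff_aux (p := p) m hm
    refine (hcle m).trans (h.le.trans ?_)
    gcongr
    exact_mod_cast he
  have hcN : ‖c (n₀ + 1)‖ = (1 / p : ℝ) ^ (n₀ + 1) := by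
    have h1 : ‖((n₀ + 1 : ℕ) : ℚ_[p])‖ = 1 :=
      Padic.norm_natCast_eq_one_iff.2 ((Nat.Prime.coprime_iff_not_dvd hpp).2
        (fun h => by have := Nat.le_of_dvd (Nat.succ_pos _) h; omega))
    have h2 : ‖(a n₀ : ℚ_[p])‖ = 1 := h₀
    simp only [c, Nat.add_sub_cancel]
    rw [norm_mul, norm_div, h1, h2, norm_pow, Padic.norm_p]
    simp
  have key := strassman (n₀ + 1) c hct ((1 / p : ℝ) ^ (n₀ + 2))
    (by rw [hcN]; exact pow_lt_pow_right_of_lt_one₀ hr0 hr1 (by omega))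
    (fun m hm => by
      obtain ⟨e, he, h⟩ := norm_coeff_aux (p := p) m (by omega)
      refine (hcle m).trans (h.le.trans ?_)
      obtain ⟨k, rfl⟩ := Nat.exists_eq_add_of_le (exp_aux hp he hm)
      rw [pow_add, pow_add, ← mul_assoc, ← mul_assoc, ← mul_pow, mul_one_div_cancel hp0.ne',
        one_pow, one_mul]
      exact mul_le_of_le_one_right (by positivity) (pow_le_one₀ hr0.le hr1.le))
  have hsub : {x : ℚ_[p] | ‖x‖ ≤ 1 / p ∧
        ∑' n : ℕ, ((a n : ℚ_[p]) / ((n : ℚ_[p]) + 1)) * x ^ (n + 1) = 0} ⊆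
      Set.image (fun y => (p : ℚ_[p]) * y)
        {x : ℚ_[p] | ‖x‖ ≤ 1 ∧ ∑' n : ℕ, c n * x ^ n = 0} := by
    rintro x ⟨hx, hx0⟩
    have hy : ‖x / p‖ ≤ 1 := by
      rw [norm_div, Padic.norm_p, div_inv_eq_mul]
      calc ‖x‖ * p ≤ 1 / p * p := by gcongr
        _ = 1 := by field_simp
    refine ⟨x / p, ⟨hy, ?_⟩, by field_simp⟩
    rw [(summable_aux hct hy).tsum_eq_zero_add, ← hx0]
    have : c 0 = 0 := by simp [c]
    rw [this, zero_mul, zero_add]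
    refine tsum_congr fun n => ?_
    simp only [c, Nat.add_sub_cancel]
    rw [div_pow]
    push_cast
    field_simp
  calc _ ≤ _ := Set.encard_le_encard hsub
    _ ≤ _ := Set.encard_image_le _ _
    _ ≤ _ := key
    _ = _ := by push_cast; rfl
end

section
/- Let p be a prime, let d be a natural number, and let G be a finitely generated additive subgroup of the ℚ_p-vector space Fin d → ℚ_p. Then the topological closure of G (as a subset of Fin d → ℚ_p with its product topology) equals the ℤ_p-submodule of Fin d → ℚ_p spanned by G. -/
/-- The closure of a finitely generated subgroup of the `ℚ_p`-vector space
`ℚ_p^d` is its `ℤ_p`-span (the fact underlying Chabauty's dimension bound). -/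
theorem closure_eq_zp_span (p : ℕ) [Fact p.Prime] (d : ℕ)
    (G : AddSubgroup (Fin d → ℚ_[p])) (hG : G.FG) :
    closure (G : Set (Fin d → ℚ_[p])) =
      (Submodule.span ℤ_[p] (G : Set (Fin d → ℚ_[p])) : Set (Fin d → ℚ_[p])) := by
  have hc : ContinuousSMul ℤ_[p] ℚ_[p] := by
    refine ⟨?_⟩
    have h : Continuous fun x : ℤ_[p] × ℚ_[p] => (x.1 : ℚ_[p]) * x.2 :=
      (continuous_subtype_val.comp continuous_fst).mul continuous_snd
    exact h
  apply Set.Subset.antisymm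
  · have hfg : (Submodule.span ℤ_[p] (G : Set (Fin d → ℚ_[p]))).FG := by
      obtain ⟨S, rfl⟩ := hG
      refine ⟨S, le_antisymm (Submodule.span_mono AddSubgroup.subset_closure) ?_⟩
      rw [Submodule.span_le]
      have : AddSubgroup.closure (S : Set (Fin d → ℚ_[p])) ≤
          (Submodule.span ℤ_[p] (S : Set (Fin d → ℚ_[p]))).toAddSubgroup := by
        rw [AddSubgroup.closure_le]
        exact Submodule.subset_span
      exact this
    exact closure_minimal Submodule.subset_span (Submodule.isCompact_of_fg hfg).isClosed
  · intro x hx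
    change x ∈ closure (G : Set (Fin d → ℚ_[p]))
    rw [← AddSubgroup.topologicalClosure_coe]
    induction hx using Submodule.span_induction with
    | mem x h => exact subset_closure h
    | zero => exact zero_mem _
    | add x y _ _ hx hy => exact add_mem hx hy
    | smul a x _ hx =>
      refine PadicInt.denseRange_intCast.induction_on a ?_ ?_
      · exact (AddSubgroup.isClosed_topologicalClosure G).preimage
          (continuous_id.smul continuous_const)
      · intro n
        rw [Int.cast_smul_eq_zsmul]
        exact zsmul_mem hx n
end

section
/- Let p be a prime. For every x ∈ ℚ_p with ‖x‖ < 1, the family n ↦ (−1)^(n+1) · xⁿ / n (for n ≥ 1) is summable in ℚ_p; write L(x) for its sum. Then for all x, y ∈ ℚ_p with ‖x‖ < 1 and ‖y‖ < 1, one has ‖x + y + x·y‖ < 1 and L(x + y + x·y) = L(x) + L(y). -/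
variable {p : ℕ} [Fact p.Prime]

/-- The `p`-adic logarithm `L(x) = log(1+x) = ∑_{n ≥ 1} (-1)^(n+1)·xⁿ/n` given by the
Mercator series.  (The term at `n = 0` vanishes since division by `0` is `0`.) -/
noncomputable def padicLog (x : ℚ_[p]) : ℚ_[p] :=
  ∑' n : ℕ, (-1) ^ (n + 1) * x ^ n / (n : ℚ_[p])

open Filter Topology

lemma padicLog_aux_inv_norm (p : ℕ) [Fact p.Prime] (n : ℕ) : ‖(n : ℚ_[p])‖⁻¹ ≤ (n : ℝ) := by
  rcases Nat.eq_zero_or_pos n with rfl | hn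
  · simp
  · have hn0 : (n : ℚ_[p]) ≠ 0 := by exact_mod_cast hn.ne'
    rw [Padic.norm_eq_zpow_neg_valuation hn0, Padic.valuation_natCast, zpow_neg, inv_inv,
      zpow_natCast]
    exact_mod_cast Nat.le_of_dvd hn pow_padicValNat_dvd

lemma padicLog_aux_bound (p : ℕ) [Fact p.Prime] (x c : ℚ_[p]) (hc : ‖c‖ ≤ 1) (n : ℕ) :
    ‖c * x ^ n / (n : ℚ_[p])‖ ≤ (n : ℝ) * ‖x‖ ^ n := by
  rw [norm_div, norm_mul, norm_pow, div_eq_mul_inv]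
  have h := padicLog_aux_inv_norm p n
  calc ‖c‖ * ‖x‖ ^ n * ‖(n : ℚ_[p])‖⁻¹ ≤ 1 * ‖x‖ ^ n * (n : ℝ) := by gcongr
    _ = _ := by ring

lemma padicLog_aux_summable_bound (r : ℝ) (h0 : 0 ≤ r) (h1 : r < 1) :
    Summable (fun n : ℕ => (n : ℝ) * r ^ n) := by
  simpa using summable_pow_mul_geometric_of_norm_lt_one (R := ℝ) 1
    (r := r) (by rwa [Real.norm_of_nonneg h0])

lemma padicLog_aux_pow (p : ℕ) [Fact p.Prime] :
    Tendsto (fun k : ℕ => (p : ℚ_[p]) ^ k) atTop (𝓝 0) :=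
  tendsto_pow_atTop_nhds_zero_of_norm_lt_one Padic.norm_p_lt_one

lemma padicLog_aux_succ (p : ℕ) [Fact p.Prime] (k : ℕ) : p ^ k - 1 + 1 = p ^ k :=
  Nat.sub_add_cancel (Nat.one_le_pow _ _ (Fact.out : p.Prime).pos)

lemma padicLog_aux_mul (p : ℕ) [Fact p.Prime] (k m : ℕ) :
    (p : ℚ_[p]) ^ k * ((p ^ k - 1).choose m : ℚ_[p]) =
      ((p ^ k).choose (m + 1) : ℚ_[p]) * ((m : ℚ_[p]) + 1) := by
  have h := Nat.add_one_mul_choose_eq (p ^ k - 1) m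
  simp only [Nat.succ_eq_add_one, padicLog_aux_succ] at h
  exact_mod_cast h

lemma padicLog_aux_norm_nat (p : ℕ) [Fact p.Prime] (n : ℕ) : ‖(n : ℚ_[p])‖ ≤ 1 := by
  simpa using Padic.norm_int_le_one (p := p) (n : ℤ)

lemma padicLog_aux_choose (p : ℕ) [Fact p.Prime] (m : ℕ) :
    Tendsto (fun k : ℕ => ((p ^ k - 1).choose m : ℚ_[p])) atTop (𝓝 ((-1) ^ m)) := by
  induction m with
  | zero => simp
  | succ m ih =>
    have hm : (m : ℚ_[p]) + 1 ≠ 0 := by exact_mod_cast Nat.succ_ne_zero m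
    have h := (((padicLog_aux_pow p).mul ih).div_const ((m : ℚ_[p]) + 1)).sub ih
    have e : (0 * (-1) ^ m / ((m : ℚ_[p]) + 1) - (-1) ^ m) = (-1) ^ (m + 1) := by ring
    rw [e] at h
    refine h.congr fun k => ?_
    rw [padicLog_aux_mul, mul_div_cancel_right₀ _ hm]
    have := Nat.choose_succ_succ (p ^ k - 1) m
    simp only [Nat.succ_eq_add_one, padicLog_aux_succ] at this
    rw [this]
    push_cast
    ring

lemma padicLog_aux_tsum (p : ℕ) [Fact p.Prime] (x : ℚ_[p]) (k : ℕ) :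
    ∑' n : ℕ, ((p ^ k - 1).choose (n - 1) : ℚ_[p]) * x ^ n / (n : ℚ_[p]) =
      ((1 + x) ^ p ^ k - 1) / (p : ℚ_[p]) ^ k := by
  have hp : (p : ℚ_[p]) ^ k ≠ 0 :=
    pow_ne_zero _ (by exact_mod_cast (Fact.out : p.Prime).ne_zero)
  rw [tsum_eq_sum (s := Finset.range (p ^ k + 1)), add_comm 1 x, add_pow,
    Finset.sum_range_succ', Finset.sum_range_succ']
  · simp only [one_pow, mul_one, Nat.add_sub_cancel, Nat.cast_zero, div_zero, add_zero, pow_zero,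
      Nat.choose_zero_right, Nat.cast_one, add_sub_cancel_right]
    rw [Finset.sum_div]
    refine Finset.sum_congr rfl fun m _ => ?_
    have hm : (m : ℚ_[p]) + 1 ≠ 0 := by exact_mod_cast Nat.succ_ne_zero m
    have h := padicLog_aux_mul p k m
    push_cast
    rw [div_eq_div_iff hm hp]
    linear_combination x ^ (m + 1) * h
  · intro n hn
    rw [Finset.mem_range, not_lt] at hn
    rw [Nat.choose_eq_zero_of_lt (by have := padicLog_aux_succ p k; omega)]
    simp

lemma padicLog_aux_lim (p : ℕ) [Fact p.Prime] (x : ℚ_[p]) (hx : ‖x‖ < 1) :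
    Tendsto (fun k : ℕ => ((1 + x) ^ p ^ k - 1) / (p : ℚ_[p]) ^ k) atTop (𝓝 (padicLog x)) := by
  simp only [← padicLog_aux_tsum]
  unfold padicLog
  refine tendsto_tsum_of_dominated_convergence
    (padicLog_aux_summable_bound ‖x‖ (norm_nonneg _) hx) (fun n => ?_)
    (Eventually.of_forall fun k n => padicLog_aux_bound p x _ (padicLog_aux_norm_nat p _) n)
  cases n with
  | zero => simp
  | succ m =>
    have e : (-1 : ℚ_[p]) ^ (m + 1 + 1) = (-1) ^ m := by ring
    rw [e]
    exact ((padicLog_aux_choose p m).mul_const _).div_const _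

/-- The Mercator series converges on the open unit disc of `ℚ_p` and the resulting
`p`-adic logarithm turns multiplication of 1-units `(1+x)(1+y) = 1 + (x+y+xy)`
into addition: `L(x+y+xy) = L(x) + L(y)`. -/
theorem padicLog_summable_and_add (p : ℕ) [Fact p.Prime] :
    (∀ x : ℚ_[p], ‖x‖ < 1 →
        Summable (fun n : ℕ => (-1 : ℚ_[p]) ^ (n + 1) * x ^ n / (n : ℚ_[p]))) ∧
      ∀ x y : ℚ_[p], ‖x‖ < 1 → ‖y‖ < 1 →
        ‖x + y + x * y‖ < 1 ∧
          padicLog (x + y + x * y) = padicLog x + padicLog y := by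
  refine ⟨fun x hx => ?_, fun x y hx hy => ?_⟩
  · exact Summable.of_norm_bounded (padicLog_aux_summable_bound ‖x‖ (norm_nonneg _) hx)
      fun n => padicLog_aux_bound p x _ (by simp) n
  · have hxy : ‖x + y + x * y‖ < 1 := by
      refine lt_of_le_of_lt (Padic.nonarchimedean _ _) (max_lt ?_ ?_)
      · exact lt_of_le_of_lt (Padic.nonarchimedean _ _) (max_lt hx hy)
      · rw [norm_mul]
        exact mul_lt_one_of_nonneg_of_lt_one_left (norm_nonneg _) hx hy.le
    refine ⟨hxy, ?_⟩
    have hX := padicLog_aux_lim p x hx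
    have hY := padicLog_aux_lim p y hy
    have h := (hX.add hY).add (((padicLog_aux_pow p).mul hX).mul hY)
    rw [zero_mul, zero_mul, add_zero] at h
    refine tendsto_nhds_unique (padicLog_aux_lim p _ hxy) (h.congr fun k => ?_)
    have hp : (p : ℚ_[p]) ^ k ≠ 0 :=
      pow_ne_zero _ (by exact_mod_cast (Fact.out : p.Prime).ne_zero)
    have e : 1 + (x + y + x * y) = (1 + x) * (1 + y) := by ring
    rw [e, mul_pow]
    generalize (1 + x) ^ p ^ k = u
    generalize (1 + y) ^ p ^ k = v
    field_simp
    ring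
end
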